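/- arXiv:2504.04846 — 5 statements merged into one kernel-verified Lean document; each statement's English description precedes it below -/
import Mathlib

section
/- Let F be a differential field with field of constants C in which no element f satisfies f' = 1, and let F(x) be the rational function field over F with derivation extended by x' = 1. If η ∈ F[x] is written η = f_0 + f_1·x + ⋯ + f_n·x^n with f_i ∈ F, and η^(r) ∈ F for some r ≥ 1, then f_1, …, f_n are constants (elements of C) and n ≤ r; in other words η = f + P for some f ∈ F and some polynomial P ∈ C[x] of degree at most r. -/
open Polynomial in
/-- An additive map satisfying the Leibniz rule, as a derivation over the integers. -/
noncomputable def mkDer {K : Type*} [Field K] (D : K → K)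
    (hadd : ∀ a b : K, D (a + b) = D a + D b)
    (hmul : ∀ a b : K, D (a * b) = a * D b + D a * b) : Derivation ℤ K K :=
  Derivation.mk' (AddMonoidHom.mk' D hadd).toIntLinearMap (by
    intro a b
    simp [hmul, mul_comm])

theorem mkDer_apply {K : Type*} [Field K] (D : K → K)
    (hadd : ∀ a b : K, D (a + b) = D a + D b)
    (hmul : ∀ a b : K, D (a * b) = a * D b + D a * b) (a : K) :
    mkDer D hadd hmul a = D a := rfl

/-- The key step: a nilpotent element is constant. -/
theorem key_step {F : Type*} [Field F] (d : Derivation ℤ F F) (hno : ¬ ∃ f : F, d f = 1)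
    (k : ℕ) : ∀ a : F, d^[k + 1] a = 0 → d a = 0 := by
  induction k with
  | zero => intro a h; simpa using h
  | succ k ih =>
    intro a h
    have h2 : d (d a) = 0 := ih (d a) (by simpa [Function.iterate_succ_apply] using h)
    by_contra hne
    apply hno
    refine ⟨(d a)⁻¹ * a, ?_⟩
    rw [Derivation.leibniz, Derivation.leibniz_inv, h2]
    simp [hne]

/-- The action of the derivation on coefficient sequences. -/
def seqD {F : Type*} [Field F] (d : Derivation ℤ F F) (a : ℕ → F) : ℕ → F :=
  fun m => d (a m) + a (m + 1) * ((m : F) + 1)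

theorem der_natCast_add_one {F : Type*} [Field F] (d : Derivation ℤ F F) (m : ℕ) :
    d ((m : F) + 1) = 0 := by
  have := d.map_natCast (m + 1)
  simpa using this

theorem seqD_iter {F : Type*} [Field F] (d : Derivation ℤ F F) (a : ℕ → F) (m : ℕ)
    (h : ∀ j, m < j → d (a j) = 0) (k : ℕ) :
    ∀ j, m < j → (seqD d)^[k] a j = a (j + k) * ((j + 1).ascFactorial k : F)
      ∧ d ((seqD d)^[k] a j) = 0 := by
  induction k with
  | zero => intro j hj; simpa using h j hj
  | succ k ih =>
    intro j hj
    have e : (seqD d)^[k + 1] a j = a (j + (k + 1)) * ((j + 1).ascFactorial (k + 1) : F) := by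
      rw [Function.iterate_succ_apply']
      simp only [seqD]
      rw [(ih j hj).2, (ih (j + 1) (by omega)).1, show j + 1 + k = j + (k + 1) by omega]
      have hasc : (j + 1).ascFactorial (k + 1) = (j + 1) * (j + 1 + 1).ascFactorial k := by
        rw [Nat.ascFactorial_succ, ← Nat.succ_ascFactorial]
      rw [hasc]
      push_cast
      ring
    refine ⟨e, ?_⟩
    rw [e, Derivation.leibniz, h _ (by omega), d.map_natCast]
    simp

theorem seqD_iter_der {F : Type*} [Field F] (d : Derivation ℤ F F) (a : ℕ → F) (m : ℕ)
    (h : ∀ j, m < j → d (a j) = 0) (k : ℕ) :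
    d ((seqD d)^[k] a m) = d^[k + 1] (a m) := by
  induction k with
  | zero => simp
  | succ k ih =>
    rw [Function.iterate_succ_apply', Function.iterate_succ_apply' (f := d), ← ih]
    simp only [seqD]
    rw [map_add, Derivation.leibniz, (seqD_iter d a m h k (m + 1) (by omega)).2,
      der_natCast_add_one]
    simp

theorem seq_main {F : Type*} [Field F] [CharZero F] (d : Derivation ℤ F F)
    (hno : ¬ ∃ f : F, d f = 1) (a : ℕ → F) (n : ℕ) (hn : a n ≠ 0)
    (ha : ∀ j, n < j → a j = 0) (r : ℕ) (hr : 1 ≤ r)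
    (hz : ∀ m, 1 ≤ m → (seqD d)^[r] a m = 0) :
    (∀ m, 1 ≤ m → d (a m) = 0) ∧ n ≤ r := by
  have hc : ∀ t m, 1 ≤ m → n < m + t → d (a m) = 0 := by
    intro t
    induction t with
    | zero => intro m _ h; rw [ha m (by omega), map_zero]
    | succ t ih =>
      intro m hm h
      have hj : ∀ j, m < j → d (a j) = 0 := fun j hj => ih j (by omega) (by omega)
      refine key_step d hno r _ ?_
      rw [← seqD_iter_der d a m hj, hz m hm, map_zero]
  have hc' : ∀ m, 1 ≤ m → d (a m) = 0 := fun m hm => hc (n + 1) m hm (by omega)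
  refine ⟨hc', ?_⟩
  by_contra hlt
  have e := (seqD_iter d a 0 (fun j hj => hc' j hj) r (n - r) (by omega)).1
  rw [hz _ (by omega), show n - r + r = n by omega] at e
  have hne : ((n - r + 1).ascFactorial r : F) ≠ 0 :=
    Nat.cast_ne_zero.mpr (Nat.ascFactorial_pos _ _).ne'
  exact mul_ne_zero hn hne e.symm

open Polynomial in
/-- Apply a derivation to each coefficient. -/
noncomputable def coeffD {F : Type*} [Field F] (d : Derivation ℤ F F) (p : F[X]) : F[X] :=
  ∑ n ∈ p.support, monomial n (d (p.coeff n))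

theorem coeffD_coeff {F : Type*} [Field F] (d : Derivation ℤ F F) (p : Polynomial F) (m : ℕ) :
    (coeffD d p).coeff m = d (p.coeff m) := by
  rw [coeffD, Polynomial.finsetSum_coeff]
  simp only [Polynomial.coeff_monomial, Finset.sum_ite_eq', Polynomial.mem_support_iff]
  split_ifs with h
  · rfl
  · rw [Polynomial.notMem_support_iff.mp h, map_zero]

theorem coeffD_add {F : Type*} [Field F] (d : Derivation ℤ F F) (p q : Polynomial F) :
    coeffD d (p + q) = coeffD d p + coeffD d q := by
  ext m
  simp [coeffD_coeff]

theorem coeffD_monomial {F : Type*} [Field F] (d : Derivation ℤ F F) (n : ℕ) (a : F) :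
    coeffD d (Polynomial.monomial n a) = Polynomial.monomial n (d a) := by
  ext m
  rw [coeffD_coeff, Polynomial.coeff_monomial, Polynomial.coeff_monomial]
  split_ifs <;> simp

open Polynomial in
/-- The derivation on polynomials. -/
noncomputable def polyD {F : Type*} [Field F] (d : Derivation ℤ F F) (p : F[X]) : F[X] :=
  coeffD d p + derivative p

theorem polyD_iter_coeff {F : Type*} [Field F] (d : Derivation ℤ F F) (k : ℕ)
    (p : Polynomial F) : ((polyD d)^[k] p).coeff = (seqD d)^[k] p.coeff := by
  induction k with
  | zero => rfl
  | succ k ih =>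
    rw [Function.iterate_succ_apply', Function.iterate_succ_apply', ← ih]
    funext m
    simp [polyD, seqD, coeffD_coeff, Polynomial.coeff_derivative]

theorem ratD_poly {F K : Type*} [Field F] [Field K] [Algebra (Polynomial F) K]
    (d : Derivation ℤ F F) (e : Derivation ℤ K K)
    (hC : ∀ a : F, e (algebraMap (Polynomial F) K (Polynomial.C a))
      = algebraMap (Polynomial F) K (Polynomial.C (d a)))
    (hX : e (algebraMap (Polynomial F) K Polynomial.X) = 1) (p : Polynomial F) :
    e (algebraMap (Polynomial F) K p) = algebraMap (Polynomial F) K (polyD d p) := by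
  induction p using Polynomial.induction_on' with
  | add p q hp hq =>
    rw [map_add, map_add, hp, hq, ← map_add]
    congr 1
    simp only [polyD, coeffD_add, map_add]
    ring
  | monomial n a =>
    have h1 : polyD d (Polynomial.monomial n a)
        = Polynomial.C (d a) * Polynomial.X ^ n
          + Polynomial.C a * ((n : Polynomial F) * Polynomial.X ^ (n - 1)) := by
      simp only [polyD, coeffD_monomial, Polynomial.derivative_monomial]
      rw [← Polynomial.C_mul_X_pow_eq_monomial, ← Polynomial.C_mul_X_pow_eq_monomial]
      simp [mul_assoc]
    rw [h1, ← Polynomial.C_mul_X_pow_eq_monomial]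
    simp only [map_mul, map_add, map_pow, map_natCast,
      Derivation.leibniz, Derivation.leibniz_pow, hX, hC, smul_eq_mul, nsmul_eq_mul]
    ring

/-- if no element of `F` has derivative `1`, and
`η = f₀ + f₁ x + ⋯ + f_n xⁿ ∈ F[x] ⊆ F(x)` (with `x' = 1`, `f_n ≠ 0`) has
`η⁽ʳ⁾ ∈ F`, then `f₁, …, f_n` are constants and `n ≤ r`. -/
theorem stmt_4 (F : Type*) [Field F] [CharZero F]
    (DF : F → F)
    (hFadd : ∀ a b : F, DF (a + b) = DF a + DF b)
    (hFmul : ∀ a b : F, DF (a * b) = a * DF b + DF a * b)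
    (hno1 : ¬ ∃ f : F, DF f = 1)
    (DE : RatFunc F → RatFunc F)
    (hEadd : ∀ a b : RatFunc F, DE (a + b) = DE a + DE b)
    (hEmul : ∀ a b : RatFunc F, DE (a * b) = a * DE b + DE a * b)
    (hcompat : ∀ a : F, DE (algebraMap F (RatFunc F) a) = algebraMap F (RatFunc F) (DF a))
    (hX : DE RatFunc.X = 1)
    (n : ℕ) (f : Fin (n + 1) → F) (hfn : f (Fin.last n) ≠ 0)
    (η : RatFunc F)
    (hη : η = ∑ i : Fin (n + 1), algebraMap F (RatFunc F) (f i) * RatFunc.X ^ (i : ℕ))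
    (r : ℕ) (hr : 1 ≤ r)
    (hηr : DE^[r] η ∈ Set.range (algebraMap F (RatFunc F))) :
    (∀ i : Fin (n + 1), 1 ≤ (i : ℕ) → DF (f i) = 0) ∧ n ≤ r := by
  have hcoe : ∀ a : F, algebraMap F (RatFunc F) a
      = algebraMap (Polynomial F) (RatFunc F) (Polynomial.C a) := by
    intro a
    rw [RatFunc.algebraMap_C, RatFunc.algebraMap_eq_C]
  set p : Polynomial F := ∑ i : Fin (n + 1), Polynomial.C (f i) * Polynomial.X ^ (i : ℕ) with hp
  have hηp : η = algebraMap (Polynomial F) (RatFunc F) p := by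
    rw [hη, hp, map_sum]
    refine Finset.sum_congr rfl fun i _ => ?_
    rw [map_mul, map_pow, RatFunc.algebraMap_X, hcoe]
  have hpc : ∀ i : Fin (n + 1), p.coeff (i : ℕ) = f i := by
    intro i
    simp [hp, Polynomial.finsetSum_coeff, Polynomial.coeff_X_pow, Fin.val_inj]
  have hp0 : ∀ j, n < j → p.coeff j = 0 := by
    intro j hj
    rw [hp, Polynomial.finsetSum_coeff]
    refine Finset.sum_eq_zero fun i _ => ?_
    rw [Polynomial.coeff_C_mul_X_pow, if_neg]
    have := i.isLt
    omega
  let d := mkDer DF hFadd hFmul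
  have hcompat' : ∀ a : F, DE (algebraMap (Polynomial F) (RatFunc F) (Polynomial.C a))
      = algebraMap (Polynomial F) (RatFunc F) (Polynomial.C (DF a)) := by
    intro a
    rw [← hcoe, ← hcoe, hcompat]
  have hX' : DE (algebraMap (Polynomial F) (RatFunc F) Polynomial.X) = 1 := by
    rw [RatFunc.algebraMap_X, hX]
  have hiter : ∀ k, DE^[k] η = algebraMap (Polynomial F) (RatFunc F) ((polyD d)^[k] p) := by
    intro k
    induction k with
    | zero => exact hηp
    | succ k ih =>
      rw [Function.iterate_succ_apply', Function.iterate_succ_apply', ih]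
      exact ratD_poly d (mkDer DE hEadd hEmul) hcompat' hX' _
  obtain ⟨c, hc⟩ := hηr
  rw [hiter, hcoe] at hc
  have hc' := RatFunc.algebraMap_injective F hc
  have hmain := seq_main d hno1 p.coeff n (by
      have := hpc (Fin.last n)
      rw [Fin.val_last] at this
      rwa [this]) hp0 r hr (by
      intro m hm
      rw [← polyD_iter_coeff, ← hc', Polynomial.coeff_C, if_neg (by omega)])
  refine ⟨fun i hi => ?_, hmain.2⟩
  have := hmain.1 i hi
  rwa [hpc] at this
end

section
/- Let F be a differential field of characteristic zero with field of constants C in which no element z satisfies z' = 1. Let F(y) be a differential field extension of F with y ∉ F, y' ∈ F, and with field of constants C. Suppose η ∈ F(y) satisfies η^(n) = g ∈ F for some n ≥ 2, and η^(m) ∉ F for every m < n. Then there exists x ∈ F(y) with x' = 1. -/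
open Polynomial in
theorem aux_shift {F : Type*} [Field F] [CharZero F] (p q : F[X]) (hq : q ≠ 0)
    (h : p.comp (X + 1) * q = p * q.comp (X + 1)) : ∃ r : F, p = C r * q := by
  have hfin : {x : F | q.IsRoot x}.Finite := by
    by_contra hinf
    exact hq (Polynomial.eq_zero_of_infinite_isRoot q hinf)
  have hfin' : {n : ℕ | q.IsRoot (n : F)}.Finite :=
    hfin.preimage (Nat.cast_injective.injOn)
  obtain ⟨N, hN⟩ := hfin'.bddAbove
  have hne : ∀ n : ℕ, N < n → q.eval (n : F) ≠ 0 := by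
    intro n hn h0
    have := hN (show n ∈ {n : ℕ | q.IsRoot (n : F)} from h0)
    omega
  have hstep : ∀ n : ℕ, p.eval ((n : F) + 1) * q.eval (n : F)
      = p.eval (n : F) * q.eval ((n : F) + 1) := by
    intro n
    have := congrArg (Polynomial.eval (n : F)) h
    simpa using this
  have hconst : ∀ k : ℕ, p.eval ((N + 1 + k : ℕ) : F) / q.eval ((N + 1 + k : ℕ) : F)
      = p.eval ((N + 1 : ℕ) : F) / q.eval ((N + 1 : ℕ) : F) := by
    intro k
    induction k with
    | zero => simp
    | succ k ih =>
      rw [← ih]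
      have h1 := hne (N + 1 + k) (by omega)
      have h2 := hne (N + 1 + (k + 1)) (by omega)
      have h3 := hstep (N + 1 + k)
      rw [div_eq_div_iff h2 h1]
      have e : ((N + 1 + (k + 1) : ℕ) : F) = ((N + 1 + k : ℕ) : F) + 1 := by
        push_cast; ring
      rw [e]
      exact h3
  refine ⟨p.eval ((N + 1 : ℕ) : F) / q.eval ((N + 1 : ℕ) : F), ?_⟩
  rw [← sub_eq_zero]
  apply Polynomial.eq_zero_of_infinite_isRoot
  have hinj : Function.Injective (fun k : ℕ => ((N + 1 + k : ℕ) : F)) := by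
    intro a b hab
    have : N + 1 + a = N + 1 + b := Nat.cast_injective hab
    omega
  refine (Set.infinite_range_of_injective hinj).mono ?_
  rintro _ ⟨k, rfl⟩
  have h1 := hne (N + 1 + k) (by omega)
  have h2 := hconst k
  rw [div_eq_iff h1] at h2
  simp only [Set.mem_ofPred_eq, IsRoot.def, eval_sub, eval_mul, eval_C]
  rw [h2, sub_self]

open Polynomial in
theorem aux_deriv {F E : Type*} [Field F] [Field E] [Algebra F E]
    [Differential F] [Differential E] [DifferentialAlgebra F E] (g : F) (z : E)
    (hz : Differential.deriv z = algebraMap F E g) (p : F[X]) :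
    Differential.deriv (aeval z p) =
      aeval z (Differential.mapCoeffs p + C g * derivative p) := by
  rw [Differential.deriv_aeval_eq, hz]
  simp [mul_comm]

open Polynomial in
theorem aux_transc {F E : Type*} [Field F] [Field E] [Algebra F E] [CharZero F]
    [Differential F] [Differential E] [DifferentialAlgebra F E] (g : F) (y : E)
    (hy : Differential.deriv y = algebraMap F E g)
    (hyF : y ∉ Set.range (algebraMap F E))
    (hconst : ∀ e : E, Differential.deriv e = 0 → e ∈ Set.range (algebraMap F E)) :
    Transcendental F y := by
  intro halg
  have hint : IsIntegral F y := halg.isIntegral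
  set p := minpoly F y with hp
  have hmonic : p.Monic := minpoly.monic hint
  have hpos : 0 < p.natDegree := minpoly.natDegree_pos hint
  obtain ⟨d, hd⟩ : ∃ d, p.natDegree = d + 1 := ⟨p.natDegree - 1, by omega⟩
  have hlead : p.coeff (d + 1) = 1 := by rw [← hd]; exact hmonic
  set q := Differential.mapCoeffs p + C g * derivative p with hq
  have h0 : aeval y q = 0 := by
    rw [hq, ← aux_deriv g y hy, hp, minpoly.aeval, map_zero]
  have hqc : ∀ i, q.coeff i = Differential.deriv (p.coeff i)
      + g * (p.coeff (i + 1) * (i + 1)) := by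
    intro i
    simp [hq, coeff_derivative]
  have hq0 : q = 0 := by
    by_contra hne
    have h1 := minpoly.degree_le_of_ne_zero F y hne h0
    rw [← hp, degree_eq_natDegree hmonic.ne_zero, hd] at h1
    have h2 : q.degree < ((d + 1 : ℕ) : WithBot ℕ) := by
      rw [degree_lt_iff_coeff_zero]
      intro m hm
      rw [hqc, coeff_eq_zero_of_natDegree_lt (n := m + 1) (by omega)]
      rcases hm.eq_or_lt with h | h
      · rw [← h, hlead]; simp
      · rw [coeff_eq_zero_of_natDegree_lt (by omega)]; simp
    exact absurd h1 (not_le.mpr h2)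
  have h1 := hqc d
  rw [hq0, hlead, coeff_zero] at h1
  have h2 : Differential.deriv (algebraMap F E (p.coeff d) + ((d + 1 : ℕ) : E) * y) = 0 := by
    rw [map_add, Derivation.leibniz, Derivation.map_natCast, deriv_algebraMap, hy]
    have := congrArg (algebraMap F E) h1
    simp only [map_zero, map_add, map_mul, map_one, map_natCast] at this
    simp only [smul_eq_mul, mul_zero, add_zero]
    rw [Nat.cast_add, Nat.cast_one]
    linear_combination -this
  obtain ⟨c, hc⟩ := hconst _ h2
  apply hyF
  have hn : ((d + 1 : ℕ) : F) ≠ 0 := by exact_mod_cast Nat.succ_ne_zero d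
  have hn' : ((d + 1 : ℕ) : E) ≠ 0 := by
    have := (map_ne_zero (algebraMap F E)).mpr hn
    rwa [map_natCast] at this
  refine ⟨(c - p.coeff d) / ((d + 1 : ℕ) : F), ?_⟩
  rw [map_div₀, map_sub, hc, map_natCast, div_eq_iff hn']
  ring

open Polynomial in
theorem aux_main {F E : Type*} [Field F] [Field E] [Algebra F E] [CharZero F]
    [Differential F] [Differential E] [DifferentialAlgebra F E] (g₀ : F) (y : E)
    (hy : Differential.deriv y = algebraMap F E g₀)
    (hyF : y ∉ Set.range (algebraMap F E))
    (hconst : ∀ e : E, Differential.deriv e = 0 → e ∈ Set.range (algebraMap F E))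
    (hgen : IntermediateField.adjoin F {y} = ⊤)
    (v : E) (g : F) (hv : Differential.deriv (Differential.deriv v) = algebraMap F E g)
    (hw : Differential.deriv v ∉ Set.range (algebraMap F E)) :
    ∃ x : E, Differential.deriv x = 1 := by
  have htr := transcendental_iff.mp (aux_transc g₀ y hy hyF hconst)
  have hz : Differential.deriv (y + 1) = algebraMap F E g₀ := by simp [hy]
  have hcomp : ∀ p : F[X], aeval (y + 1) p = aeval y (p.comp (X + 1)) := by
    intro p; rw [aeval_comp]; simp
  have hcne : ∀ p : F[X], p ≠ 0 → p.comp (X + 1) ≠ 0 := by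
    intro p hp h0
    have : (p.comp (X + 1)).comp (X - 1) = p := by rw [comp_assoc]; simp
    exact hp (by rw [← this, h0, zero_comp])
  have hne1 : ∀ p : F[X], p ≠ 0 → aeval y p ≠ 0 := fun p hp h => hp (htr p h)
  have hne2 : ∀ p : F[X], p ≠ 0 → aeval (y + 1) p ≠ 0 := fun p hp h => by
    rw [hcomp] at h; exact hcne p hp (htr _ h)
  obtain ⟨δ, hδ⟩ : ∃ δ : F[X] → F[X], ∀ z : E, Differential.deriv z = algebraMap F E g₀ →
      ∀ p, Differential.deriv (aeval z p) = aeval z (δ p) :=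
    ⟨fun p => Differential.mapCoeffs p + C g₀ * derivative p, fun z h p => aux_deriv g₀ z h p⟩
  have hdiv : ∀ z : E, Differential.deriv z = algebraMap F E g₀ → ∀ r s : F[X],
      aeval z s ≠ 0 →
      Differential.deriv (aeval z r / aeval z s) = aeval z (s * δ r - r * δ s) / aeval z (s ^ 2) := by
    intro z h r s hs
    rw [Derivation.leibniz_div, hδ z h, hδ z h]
    simp only [smul_eq_mul, map_sub, map_mul, map_pow]
    field_simp
  have hvm : v ∈ IntermediateField.adjoin F {y} := by rw [hgen]; trivial
  obtain ⟨r, s, hrs⟩ := (IntermediateField.mem_adjoin_simple_iff F v).mp hvm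
  have hs : s ≠ 0 := by
    rintro rfl
    apply hw
    exact ⟨0, by simp [hrs]⟩
  set p := s * δ r - r * δ s with hp
  set q := s ^ 2 with hq
  have hq0 : q ≠ 0 := pow_ne_zero 2 hs
  have hw1 : Differential.deriv v = aeval y p / aeval y q := by
    rw [hrs]; exact hdiv y hy r s (hne1 s hs)
  have hw2 : Differential.deriv (aeval (y + 1) r / aeval (y + 1) s)
      = aeval (y + 1) p / aeval (y + 1) q := hdiv _ hz r s (hne2 s hs)
  have hpoly : q * δ p - p * δ q = C g * q ^ 2 := by
    rw [← sub_eq_zero]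
    apply htr
    rw [hw1, hdiv y hy p q (hne1 q hq0), div_eq_iff (hne1 _ (pow_ne_zero 2 hq0))] at hv
    rw [map_sub, hv, map_mul, aeval_C, sub_self]
  have hw3 : Differential.deriv (aeval (y + 1) p / aeval (y + 1) q) = algebraMap F E g := by
    rw [hdiv _ hz p q (hne2 q hq0), hpoly, map_mul, aeval_C,
      mul_div_cancel_right₀ _ (hne2 _ (pow_ne_zero 2 hq0))]
  set w := Differential.deriv v with hwdef
  set w' := aeval (y + 1) p / aeval (y + 1) q with hw'
  have hc : Differential.deriv (w' - w) = 0 := by rw [map_sub, hw3, hv, sub_self]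
  by_cases hc0 : w' - w = 0
  · exfalso
    rw [hw', hw1, sub_eq_zero, div_eq_div_iff (hne2 q hq0) (hne1 q hq0), hcomp, hcomp,
      ← map_mul, ← map_mul, ← sub_eq_zero, ← map_sub] at hc0
    obtain ⟨a, ha⟩ := aux_shift p q hq0 (sub_eq_zero.mp (htr _ hc0))
    apply hw
    refine ⟨a, ?_⟩
    rw [hw1, ha, map_mul, aeval_C, mul_div_cancel_right₀ _ (hne1 q hq0)]
  · refine ⟨(aeval (y + 1) r / aeval (y + 1) s - v) / (w' - w), ?_⟩
    rw [Derivation.leibniz_div_const _ _ _ hc, map_sub, hw2, smul_eq_mul, inv_mul_cancel₀ hc0]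

/-- if no `z ∈ F` has `z' = 1`, `F(y)` is an antiderivative
extension (`y ∉ F`, `y' ∈ F`, same constants), and `η ∈ F(y)` satisfies
`η⁽ⁿ⁾ = g ∈ F` with `n ≥ 2` and `η⁽ᵐ⁾ ∉ F` for all `m < n`, then there exists
`x ∈ F(y)` with `x' = 1`. -/
theorem stmt_9 (F E : Type*) [Field F] [Field E] [Algebra F E] [CharZero F]
    (DF : F → F)
    (hFadd : ∀ a b : F, DF (a + b) = DF a + DF b)
    (hFmul : ∀ a b : F, DF (a * b) = a * DF b + DF a * b)
    (DE : E → E)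
    (hEadd : ∀ a b : E, DE (a + b) = DE a + DE b)
    (hEmul : ∀ a b : E, DE (a * b) = a * DE b + DE a * b)
    (hcompat : ∀ a : F, DE (algebraMap F E a) = algebraMap F E (DF a))
    (hno1 : ¬ ∃ z : F, DF z = 1)
    (y : E) (hyF : y ∉ Set.range (algebraMap F E))
    (hy' : DE y ∈ Set.range (algebraMap F E))
    (hgen : IntermediateField.adjoin F {y} = ⊤)
    (hconst : ∀ e : E, DE e = 0 → ∃ c : F, DF c = 0 ∧ algebraMap F E c = e)
    (η : E) (g : F) (n : ℕ) (hn : 2 ≤ n)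
    (hηn : DE^[n] η = algebraMap F E g)
    (hηm : ∀ m < n, DE^[m] η ∉ Set.range (algebraMap F E)) :
    ∃ x : E, DE x = 1 := by
  let dF : Derivation ℤ F F := Derivation.mk' (AddMonoidHom.mk' DF hFadd).toIntLinearMap
    (fun a b => by
      show DF (a * b) = a * DF b + b * DF a
      rw [hFmul]; ring)
  let dE : Derivation ℤ E E := Derivation.mk' (AddMonoidHom.mk' DE hEadd).toIntLinearMap
    (fun a b => by
      show DE (a * b) = a * DE b + b * DE a
      rw [hEmul]; ring)
  letI : Differential F := ⟨dF⟩
  letI : Differential E := ⟨dE⟩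
  haveI : DifferentialAlgebra F E := ⟨hcompat⟩
  obtain ⟨g₀, hg₀⟩ := hy'
  obtain ⟨k, rfl⟩ : ∃ k, n = k + 2 := ⟨n - 2, by omega⟩
  have h1 : DE (DE (DE^[k] η)) = algebraMap F E g := by
    rw [← hηn, Function.iterate_succ_apply', Function.iterate_succ_apply']
  have h2 : DE (DE^[k] η) ∉ Set.range (algebraMap F E) := by
    rw [← Function.iterate_succ_apply' DE k η]
    exact hηm (k + 1) (by omega)
  exact aux_main (F := F) (E := E) g₀ y hg₀.symm hyF
    (fun e he => by
      obtain ⟨c, _, hc⟩ := hconst e he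
      exact ⟨c, hc⟩) hgen (DE^[k] η) g h1 h2
end

section
/- Let C be an algebraically closed field of characteristic zero and let E = C(x, e) be a differential field with x' = 1, e' = e, e transcendental over C(x), and field of constants C. Then g ∈ E is ∞-integrable in E if and only if g = Σ_{i=m}^{n} f_i·e^i for some integers m ≤ n and polynomials f_i ∈ C[x]. -/
open Polynomial

set_option linter.unusedSectionVars false

section poles

variable {A E : Type*} [CommRing A] [IsDomain A] [UniqueFactorizationMonoid A] [CharZero A]
  [Field E]

/-- pole of order `m + 1` at `p`. -/
def PoleAt (φ : A →+* E) (p : A) (m : ℕ) (f : E) : Prop :=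
  ∃ a b : A, ¬ p ∣ a ∧ ¬ p ∣ b ∧ f * φ p ^ (m + 1) * φ b = φ a

/-- regular at `p`. -/
def RegAt (φ : A →+* E) (p : A) (f : E) : Prop :=
  ∃ a b : A, ¬ p ∣ b ∧ f * φ b = φ a

lemma PoleAt.step {φ : A →+* E} {p : A} (hp : Prime p) (D : Derivation ℤ E E) (d : A → A)
    (hd : ∀ a, D (φ a) = φ (d a)) (hpd : ¬ p ∣ d p) (hk : ∀ k : ℕ, ¬ p ∣ ((k + 1 : ℕ) : A))
    {m : ℕ} {f : E} (h : PoleAt φ p m f) : PoleAt φ p (m + 1) (D f) := by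
  obtain ⟨a, b, ha, hb, h⟩ := h
  refine ⟨p * (b * d a - a * d b) - (m + 1 : ℕ) * (a * (b * d p)), b * b, ?_, ?_, ?_⟩
  · intro hdv
    have h2 : p ∣ (m + 1 : ℕ) * (a * (b * d p)) := by
      have := dvd_sub (Dvd.intro (b * d a - a * d b) rfl) hdv
      simpa using this
    rcases hp.dvd_or_dvd h2 with h | h
    · exact hk m h
    rcases hp.dvd_or_dvd h with h | h
    · exact ha h
    rcases hp.dvd_or_dvd h with h | h
    · exact hb h
    · exact hpd h
  · intro h
    rcases hp.dvd_or_dvd h with h | h <;> exact hb h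
  · have h1 := congrArg D h
    simp only [Derivation.leibniz, Derivation.leibniz_pow, hd, smul_eq_mul, nsmul_eq_mul,
      Nat.add_sub_cancel] at h1
    simp only [map_sub, map_mul, map_natCast, ← h1, ← h]
    push_cast
    ring

lemma RegAt.step {φ : A →+* E} {p : A} (hp : Prime p) (D : Derivation ℤ E E) (d : A → A)
    (hd : ∀ a, D (φ a) = φ (d a)) {f : E} (h : RegAt φ p f) : RegAt φ p (D f) := by
  obtain ⟨a, b, hb, h⟩ := h
  refine ⟨d a * b - a * d b, b * b, ?_, ?_⟩
  · intro h
    rcases hp.dvd_or_dvd h with h | h <;> exact hb h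
  · have h1 := congrArg D h
    simp only [Derivation.leibniz, hd, smul_eq_mul] at h1
    simp only [map_sub, map_mul, ← h1, ← h]
    ring

lemma not_dvd_den {φ : A →+* E} (hφ : Function.Injective φ) {p : A} (hp : Prime p)
    (D : Derivation ℤ E E) (d : A → A)
    (hd : ∀ a, D (φ a) = φ (d a)) (hpd : ¬ p ∣ d p) (hk : ∀ k : ℕ, ¬ p ∣ ((k + 1 : ℕ) : A))
    (hs : ∀ z : E, ∃ a b : A, b ≠ 0 ∧ IsRelPrime a b ∧ z * φ b = φ a) (g : E)
    (hg : ∀ n : ℕ, 1 ≤ n → ∃ η : E, D^[n] η = g)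
    (a b : A) (hb : b ≠ 0) (hab : IsRelPrime a b) (h : g * φ b = φ a) : ¬ p ∣ b := by
  have key : ∀ (z : E) (a b : A), b ≠ 0 → IsRelPrime a b → z * φ b = φ a → p ∣ b →
      ∃ m, PoleAt φ p m z := by
    intro z a b hb hab h hpb
    obtain ⟨c, hc, hnc⟩ :=
      (FiniteMultiplicity.of_not_isUnit hp.not_isUnit hb).exists_eq_pow_mul_and_not_dvd
    have hm : multiplicity p b ≠ 0 := by
      intro h0
      rw [h0, pow_zero, one_mul] at hc
      exact hnc (hc ▸ hpb)
    obtain ⟨m, hm⟩ := Nat.exists_eq_succ_of_ne_zero hm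
    refine ⟨m, a, c, fun hpa => hp.not_isUnit (hab hpa hpb), hnc, ?_⟩
    rw [← h]
    conv_rhs => rw [hc, hm]
    simp only [map_mul, map_pow, Nat.succ_eq_add_one]
    ring
  intro hpb
  obtain ⟨m, hm⟩ := key g a b hb hab h hpb
  obtain ⟨η, hη⟩ := hg (m + 1) (by omega)
  obtain ⟨a', b', hb', hab', h'⟩ := hs η
  obtain ⟨u, v, hu, hv, huv⟩ := hm
  by_cases hpb' : p ∣ b'
  · obtain ⟨j, hj⟩ := key η a' b' hb' hab' h' hpb'
    have : ∀ n, PoleAt φ p (j + n) (D^[n] η) := by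
      intro n
      induction n with
      | zero => exact hj
      | succ n ih =>
        rw [Function.iterate_succ_apply']
        exact ih.step hp D d hd hpd hk
    have := this (m + 1)
    rw [hη] at this
    obtain ⟨s, t, hs, ht, hst⟩ := this
    have h3 : s * v = p * (p ^ j * u * t) := by
      apply hφ
      simp only [map_mul, map_pow, ← huv, ← hst]
      ring
    rcases hp.dvd_or_dvd (Dvd.intro _ h3.symm) with h | h
    · exact hs h
    · exact hv h
  · have : ∀ n, RegAt φ p (D^[n] η) := by
      intro n
      induction n with
      | zero => exact ⟨a', b', hpb', h'⟩
      | succ n ih =>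
        rw [Function.iterate_succ_apply']
        exact ih.step hp D d hd
    have := this (m + 1)
    rw [hη] at this
    obtain ⟨s, t, ht, hst⟩ := this
    have h3 : u * t = p * (p ^ m * s * v) := by
      apply hφ
      simp only [map_mul, map_pow, ← huv, ← hst]
      ring
    rcases hp.dvd_or_dvd (Dvd.intro _ h3.symm) with h | h
    · exact hu h
    · exact ht h

end poles

section poly

variable {C : Type*} [Field C] [CharZero C]

/-- the derivation on `C[x][e]`. -/
noncomputable def dPoly (P : C[X][X]) : C[X][X] :=
  ∑ i ∈ Finset.range (P.natDegree + 1),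
    monomial i (derivative (P.coeff i) + (i : C[X]) * P.coeff i)

lemma coeff_dPoly (P : C[X][X]) (n : ℕ) :
    (dPoly P).coeff n = derivative (P.coeff n) + (n : C[X]) * P.coeff n := by
  simp only [dPoly, finsetSum_coeff, coeff_monomial, Finset.sum_ite_eq', Finset.mem_range]
  split_ifs with h
  · rfl
  · rw [coeff_eq_zero_of_natDegree_lt (by omega)]
    simp

lemma ode_const (c : C) (f : C[X]) (hf : f ≠ 0) (h : derivative f = Polynomial.C c * f) :
    c = 0 ∧ ∃ u : C, f = Polynomial.C u := by
  have hc : c = 0 := by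
    by_contra hc
    have h1 := degree_derivative_lt hf
    rw [h, degree_C_mul hc] at h1
    exact lt_irrefl _ h1
  refine ⟨hc, ?_⟩
  rw [hc] at h
  simp only [map_zero, zero_mul] at h
  exact ⟨_, eq_C_of_derivative_eq_zero h⟩

lemma prime_assoc (p : C[X][X]) (hp : Prime p) (h : p ∣ dPoly p) : p ∣ X := by
  obtain ⟨r, hr⟩ := h
  have hp0 := hp.ne_zero
  have hr0 : ∃ q, r = Polynomial.C q := by
    by_cases h0 : r = 0
    · exact ⟨0, by simp [h0]⟩
    have h1 : (dPoly p).natDegree ≤ p.natDegree := by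
      rw [natDegree_le_iff_coeff_eq_zero]
      intro n hn
      rw [coeff_dPoly, coeff_eq_zero_of_natDegree_lt hn]
      simp
    rw [hr, natDegree_mul hp0 h0] at h1
    exact ⟨_, eq_C_of_natDegree_eq_zero (by omega)⟩
  obtain ⟨q, rfl⟩ := hr0
  have hco : ∀ n, derivative (p.coeff n) + (n : C[X]) * p.coeff n = p.coeff n * q := by
    intro n
    rw [← coeff_dPoly, hr, coeff_mul_C]
  have hq : ∃ c, q = Polynomial.C c := by
    by_cases hq0 : q = 0
    · exact ⟨0, by simp [hq0]⟩
    have hl : p.leadingCoeff ≠ 0 := leadingCoeff_ne_zero.mpr hp0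
    have h1 := hco p.natDegree
    change derivative p.leadingCoeff + _ * p.leadingCoeff = p.leadingCoeff * q at h1
    have h2 : (p.leadingCoeff * q).natDegree ≤ p.leadingCoeff.natDegree := by
      rw [← h1]
      refine natDegree_add_le_of_degree_le ?_ ?_
      · exact (natDegree_derivative_le _).trans (Nat.sub_le _ _)
      · refine natDegree_mul_le.trans ?_
        simp
    rw [natDegree_mul hl hq0] at h2
    exact ⟨_, eq_C_of_natDegree_eq_zero (by omega)⟩
  obtain ⟨c, rfl⟩ := hq
  have hn : ∀ n, p.coeff n ≠ 0 → c = n ∧ ∃ u : C, p.coeff n = Polynomial.C u := by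
    intro n hn
    have h1 : derivative (p.coeff n) = Polynomial.C (c - n) * p.coeff n := by
      have := hco n
      simp only [map_sub, map_natCast]
      linear_combination this
    obtain ⟨h2, h3⟩ := ode_const _ _ hn h1
    exact ⟨sub_eq_zero.mp h2, h3⟩
  obtain ⟨hc, u, hu⟩ := hn p.natDegree (leadingCoeff_ne_zero.mpr hp0)
  have hu0 : u ≠ 0 := by
    rintro rfl
    apply hp0
    rw [← leadingCoeff_eq_zero, leadingCoeff, hu, map_zero]
  have hpe : p = monomial p.natDegree (Polynomial.C u) := by
    ext1 n
    rw [coeff_monomial]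
    split_ifs with h
    · rw [← h, hu]
    · by_contra h0
      have := (hn n h0).1
      rw [hc] at this
      exact h (by exact_mod_cast this)
  have h5 : p ∣ X ^ p.natDegree := by
    refine ⟨Polynomial.C (Polynomial.C u⁻¹), ?_⟩
    conv_rhs => rw [hpe]
    rw [mul_comm, C_mul_monomial, ← map_mul, inv_mul_cancel₀ hu0]
    simp [← X_pow_eq_monomial]
  exact hp.dvd_of_dvd_pow h5

lemma dvd_X_pow (b : C[X][X]) : b ≠ 0 → (∀ p, Prime p → p ∣ b → p ∣ X) → ∃ k : ℕ, b ∣ X ^ k := by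
  refine UniqueFactorizationMonoid.induction_on_prime b ?_ ?_ ?_
  · intro h
    exact absurd rfl h
  · intro x hx _ _
    exact ⟨0, hx.dvd⟩
  · intro a p ha hp ih _ h
    obtain ⟨k, hk⟩ := ih ha (fun q hq hqa => h q hq (hqa.mul_left p))
    refine ⟨k + 1, ?_⟩
    rw [pow_succ']
    exact mul_dvd_mul (h p hp (dvd_mul_right _ _)) hk

lemma ode_solve (i : ℤ) (P : C[X]) : ∃ Q : C[X], derivative Q + (i : C[X]) * Q = P := by
  have hmon : ∀ n : ℕ, ∃ Q : C[X], derivative Q + (i : C[X]) * Q = X ^ n := by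
    intro n
    by_cases hi : i = 0
    · subst hi
      refine ⟨Polynomial.C ((n + 1 : ℕ) : C)⁻¹ * X ^ (n + 1), ?_⟩
      have h : ((n + 1 : ℕ) : C) ≠ 0 := Nat.cast_ne_zero.mpr (by omega)
      rw [derivative_C_mul, derivative_X_pow, ← mul_assoc, ← map_mul, inv_mul_cancel₀ h]
      simp
    have hi' : (i : C) ≠ 0 := Int.cast_ne_zero.mpr hi
    have hI : Polynomial.C (i : C)⁻¹ * (i : C[X]) = 1 := by
      rw [← map_intCast (Polynomial.C : C →+* C[X]) i, ← map_mul, inv_mul_cancel₀ hi', map_one]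
    induction n with
    | zero =>
      refine ⟨Polynomial.C (i : C)⁻¹, ?_⟩
      rw [derivative_C, pow_zero, zero_add, mul_comm, hI]
    | succ n ih =>
      obtain ⟨Q, hQ⟩ := ih
      refine ⟨Polynomial.C (i : C)⁻¹ * (X ^ (n + 1) - Polynomial.C ((n + 1 : ℕ) : C) * Q), ?_⟩
      rw [derivative_C_mul, derivative_sub, derivative_C_mul, derivative_X_pow]
      simp only [Nat.add_sub_cancel]
      linear_combination X ^ (n + 1) * hI -
        Polynomial.C (i : C)⁻¹ * Polynomial.C ((n + 1 : ℕ) : C) * hQ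
  induction P using Polynomial.induction_on' with
  | add p q hp hq =>
    obtain ⟨P, hP⟩ := hp
    obtain ⟨Q, hQ⟩ := hq
    refine ⟨P + Q, ?_⟩
    rw [derivative_add]
    linear_combination hP + hQ
  | monomial n a =>
    obtain ⟨Q, hQ⟩ := hmon n
    refine ⟨Polynomial.C a * Q, ?_⟩
    rw [derivative_C_mul, ← C_mul_X_pow_eq_monomial]
    linear_combination Polynomial.C a * hQ

end poly

/-- in `E = C(x, eˣ)` (with `x' = 1`, `e' = e`, `e` transcendental
over `C(x)`, constants `C`), an element `g` is ∞-integrable iff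
`g = Σ_{i=m}^{n} f_i·eⁱ` with `f_i ∈ C[x]`. -/
theorem stmt_14 (C E : Type*) [Field C] [Field E] [Algebra C E]
    [CharZero C] [IsAlgClosed C]
    (D : E → E)
    (hadd : ∀ a b : E, D (a + b) = D a + D b)
    (hmul : ∀ a b : E, D (a * b) = a * D b + D a * b)
    (hCc : ∀ c : C, D (algebraMap C E c) = 0)
    (x e : E) (hx : D x = 1) (he : D e = e)
    (hxtr : Transcendental C x)
    (hetr : Transcendental (↥(IntermediateField.adjoin C {x})) e)
    (hgen : IntermediateField.adjoin C {x, e} = ⊤)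
    (hconst : ∀ c : E, D c = 0 → ∃ a : C, algebraMap C E a = c)
    (g : E) :
    (∀ n : ℕ, 1 ≤ n → ∃ η : E, D^[n] η = g) ↔
      ∃ (m n : ℤ), m ≤ n ∧ ∃ f : ℤ → E,
        (∀ i, f i ∈ Algebra.adjoin C {x}) ∧
        g = ∑ i ∈ Finset.Icc m n, f i * e ^ i := by
  have he0 : e ≠ 0 := by
    rintro rfl
    exact hetr isAlgebraic_zero
  obtain ⟨D', hD'⟩ : ∃ D' : Derivation ℤ E E, ∀ z, D' z = D z := by
    refine ⟨Derivation.mk' (AddMonoidHom.mk' D hadd).toIntLinearMap ?_, fun z => rfl⟩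
    intro a b
    simp only [AddMonoidHom.coe_toIntLinearMap, AddMonoidHom.mk'_apply, smul_eq_mul]
    rw [hmul, mul_comm (D a) b]
  have hDD : D = D' := funext fun z => (hD' z).symm
  subst hDD
  have hpolyD : ∀ P : C[X], D' (aeval x P) = aeval x (derivative P) := by
    intro P
    induction P using Polynomial.induction_on' with
    | add p q hp hq => simp [hp, hq]
    | monomial n a =>
      rw [derivative_monomial, aeval_monomial, aeval_monomial, hmul, hCc]
      simp [Derivation.leibniz_pow, hx]
      ring
  have hzD : ∀ (P : C[X]) (i : ℤ),
      D' (aeval x P * e ^ i) = aeval x (derivative P + (i : C[X]) * P) * e ^ i := by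
    intro P i
    rw [hmul, hpolyD, Derivation.leibniz_zpow, he]
    simp only [zsmul_eq_mul, smul_eq_mul, map_add, map_mul, map_intCast]
    rw [← zpow_add_one₀ he0, sub_add_cancel]
    ring
  constructor
  · intro hg
    let φ : C[X][X] →+* E := eval₂RingHom (aeval x).toRingHom e
    have hφC : ∀ P : C[X], φ (Polynomial.C P) = aeval x P := fun P => by simp [φ]
    have hφX : φ X = e := by simp [φ]
    have hφm : ∀ n P, φ (monomial n P) = aeval x P * e ^ n := fun n P => by simp [φ]
    have hφ : Function.Injective φ := by
      rw [injective_iff_map_eq_zero]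
      intro P hP
      let ψ : C[X] →ₐ[C] IntermediateField.adjoin C {x} :=
        aeval ⟨x, IntermediateField.mem_adjoin_simple_self C x⟩
      have hψ : ∀ Q, ((ψ Q : IntermediateField.adjoin C {x}) : E) = aeval x Q := by
        intro Q
        have := aeval_algebraMap_apply E
          (⟨x, IntermediateField.mem_adjoin_simple_self C x⟩ : IntermediateField.adjoin C {x}) Q
        exact this.symm
      have h1 : aeval e (P.map ψ.toRingHom) = 0 := by
        rw [← hP, aeval_def, eval₂_map]
        simp only [φ, coe_eval₂RingHom]
        congr 1
        exact RingHom.ext fun Q => hψ Q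
      have h2 : P.map ψ.toRingHom = 0 := (transcendental_iff.mp hetr) _ h1
      ext1 n
      have h3 : ψ (P.coeff n) = 0 := by
        have := congrArg (fun q => q.coeff n) h2
        simpa using this
      have h4 := hψ (P.coeff n)
      rw [h3] at h4
      exact (transcendental_iff.mp hxtr) _ (by simpa using h4.symm)
    have hd : ∀ P, D' (φ P) = φ (dPoly P) := by
      intro P
      conv_lhs => rw [P.as_sum_range]
      rw [dPoly, map_sum, map_sum, map_sum]
      refine Finset.sum_congr rfl fun i _ => ?_
      rw [hφm, hφm]
      have := hzD (P.coeff i) i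
      simpa using this
    have hs : ∀ z : E, ∃ a b : C[X][X], b ≠ 0 ∧ IsRelPrime a b ∧ z * φ b = φ a := by
      have hr : ∀ z ∈ Algebra.adjoin C {x, e}, ∃ a, φ a = z := by
        intro z hz
        induction hz using Algebra.adjoin_induction with
        | mem z hz =>
          rcases hz with rfl | rfl
          · exact ⟨Polynomial.C X, by rw [hφC, aeval_X]⟩
          · exact ⟨X, hφX⟩
        | algebraMap r => exact ⟨Polynomial.C (Polynomial.C r), by rw [hφC, aeval_C]⟩
        | add a b _ _ ha hb =>
          obtain ⟨a, rfl⟩ := ha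
          obtain ⟨b, rfl⟩ := hb
          exact ⟨a + b, map_add _ _ _⟩
        | mul a b _ _ ha hb =>
          obtain ⟨a, rfl⟩ := ha
          obtain ⟨b, rfl⟩ := hb
          exact ⟨a * b, map_mul _ _ _⟩
      intro z
      have hz : z ∈ IntermediateField.adjoin C {x, e} := by rw [hgen]; trivial
      obtain ⟨r, hr1, s, hs1, rfl⟩ := IntermediateField.mem_adjoin_iff_div.mp hz
      obtain ⟨a, rfl⟩ := hr r hr1
      obtain ⟨b, rfl⟩ := hr s hs1
      by_cases hb : b = 0
      · refine ⟨0, 1, one_ne_zero, isRelPrime_one_right, ?_⟩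
        simp [hb]
      obtain ⟨a', b', c, hab, rfl, rfl⟩ :=
        UniqueFactorizationMonoid.exists_reduced_factors' a b hb
      have hc : φ c ≠ 0 := fun h => hb (by
        rw [(injective_iff_map_eq_zero φ).mp hφ c h, zero_mul])
      have hb1 : b' ≠ 0 := by rintro rfl; exact hb (mul_zero _)
      have hb2 : φ b' ≠ 0 := fun h => hb1 ((injective_iff_map_eq_zero φ).mp hφ _ h)
      refine ⟨a', b', hb1, hab, ?_⟩
      rw [map_mul, map_mul]
      field_simp
    obtain ⟨a, b, hb, hab, h⟩ := hs g
    have hX : ∀ p, Prime p → p ∣ b → p ∣ X := by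
      intro p hp hpb
      by_contra hpX
      refine not_dvd_den hφ hp D' dPoly hd (fun h => hpX (prime_assoc p hp h)) ?_ hs g hg a b hb
        hab h hpb
      intro k hk
      refine hp.not_isUnit (isUnit_of_dvd_unit hk ?_)
      have : (((k + 1 : ℕ) : C[X][X])) = Polynomial.C (Polynomial.C ((k + 1 : ℕ) : C)) := by simp
      rw [this]
      refine IsUnit.map _ (IsUnit.map _ (IsUnit.mk0 _ ?_))
      exact Nat.cast_ne_zero.mpr (by omega)
    obtain ⟨k, c, hc⟩ := dvd_X_pow b hb hX
    have hgP : g * e ^ k = φ (a * c) := by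
      rw [map_mul, ← h, ← hφX, ← map_pow, hc, map_mul]
      ring
    generalize a * c = P at hgP
    refine ⟨-k, -k + P.natDegree, by omega,
      fun i => aeval x (P.coeff (i + k).toNat), fun i => ?_, ?_⟩
    · exact aeval_mem_adjoin_singleton C x
    · have hg2 : g = φ P * e ^ (-(k : ℤ)) := by
        rw [← hgP, zpow_neg, zpow_natCast]
        field_simp
      rw [hg2]
      conv_lhs => rw [P.as_sum_range]
      rw [map_sum, Finset.sum_mul]
      refine Finset.sum_bij (fun (i : ℕ) _ => -(k : ℤ) + i) ?_ ?_ ?_ ?_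
      · intro i hi
        simp only [Finset.mem_range] at hi
        simp only [Finset.mem_Icc]
        omega
      · intro i _ j _ hij
        omega
      · intro j hj
        simp only [Finset.mem_Icc] at hj
        exact ⟨(j + k).toNat, by simp only [Finset.mem_range]; omega, by omega⟩
      · intro i _
        have : (-(k : ℤ) + i + k).toNat = i := by omega
        simp only [this]
        rw [hφm, zpow_add₀ he0, zpow_natCast]
        ring
  · rintro ⟨m, n, hmn, f, hf, rfl⟩
    intro N _
    have hP : ∀ i, ∃ P : C[X], aeval x P = f i := by
      intro i
      have := hf i
      rw [Algebra.adjoin_singleton_eq_range_aeval] at this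
      exact this
    choose F hF using hP
    have key : ∀ (N : ℕ) (F : ℤ → C[X]), ∃ G : ℤ → C[X],
        D'^[N] (∑ i ∈ Finset.Icc m n, aeval x (G i) * e ^ i) =
          ∑ i ∈ Finset.Icc m n, aeval x (F i) * e ^ i := by
      intro N
      induction N with
      | zero => exact fun F => ⟨F, rfl⟩
      | succ N ih =>
        intro F
        choose G hG using fun i => ode_solve i (F i)
        obtain ⟨H, hH⟩ := ih G
        refine ⟨H, ?_⟩
        rw [Function.iterate_succ_apply', hH, map_sum]
        refine Finset.sum_congr rfl fun i _ => ?_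
        rw [hzD, hG]
    obtain ⟨G, hG⟩ := key N F
    refine ⟨_, hG.trans ?_⟩
    simp only [hF]
end

section
/- Let C be an algebraically closed field of characteristic zero and let E = C(x, L) be a differential field with x' = 1, L' = 1/x, L transcendental over C(x), and field of constants C. Then g ∈ E is ∞-integrable in E if and only if g = Σ_{i=0}^{n} f_i·L^i for some n ≥ 0 and Laurent polynomials f_i ∈ C[x, x^{-1}]. -/
open Polynomial in
/-- the coefficients of the derivation `x D` on `C[x][L]` -/
theorem aux_delta {C E : Type*} [Field C] [Field E] [Algebra C E]
    (D : Derivation C E E) (x L : E) (hx0 : x ≠ 0) (hx : D x = 1) (hL : D L = x⁻¹)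
    (b : C[X][X]) : ∃ d : C[X][X],
      D (eval₂ (aeval (R := C) x).toRingHom L b) * x = eval₂ (aeval (R := C) x).toRingHom L d ∧
      ∀ n, d.coeff n = X * derivative (b.coeff n) + ((n : C[X]) + 1) * b.coeff (n + 1) := by
  have hD : ∀ a : C[X], D (aeval x a) = aeval x (derivative a) := by
    intro a
    rw [Derivation.map_aeval, hx]; simp
  induction b using Polynomial.induction_on' with
  | add p q hp hq =>
    obtain ⟨d, hd, hd'⟩ := hp
    obtain ⟨e, he, he'⟩ := hq
    refine ⟨d + e, ?_, ?_⟩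
    · rw [eval₂_add, eval₂_add, ← hd, ← he, map_add]; ring
    · intro n
      simp only [coeff_add, hd', he', derivative_add]; ring
  | monomial n a =>
    refine ⟨monomial n (X * derivative a) + derivative (monomial n a), ?_, ?_⟩
    · rw [derivative_monomial, eval₂_add, eval₂_monomial, eval₂_monomial, eval₂_monomial]
      simp only [AlgHom.toRingHom_eq_coe, RingHom.coe_coe, map_mul, aeval_X, map_natCast]
      rw [Derivation.leibniz, Derivation.leibniz_pow, hD, hL]
      simp only [smul_eq_mul, nsmul_eq_mul]
      field_simp
      ring
    · intro m
      rw [coeff_add, coeff_derivative, coeff_monomial, coeff_monomial, coeff_monomial]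
      split_ifs <;> simp <;> ring

/-- poles of `D η` at a prime `p` with `p ∤ ξ`, `p ∤ δ p` -/
theorem aux_pole {C E B : Type*} [Field C] [Field E] [Algebra C E] [CharZero C]
    [CommRing B] [IsDomain B] [Algebra C B] [UniqueFactorizationMonoid B]
    (D : Derivation C E E) (φ : B →+* E) (hφ : Function.Injective φ)
    (hfrac : ∀ e : E, ∃ a b : B, b ≠ 0 ∧ e * φ b = φ a)
    (ξ : B) (δ : B → B) (hδ : ∀ b, D (φ b) * φ ξ = φ (δ b))
    (p : B) (hp : Prime p) (hpξ : ¬ p ∣ ξ) (hpδ : ¬ p ∣ δ p)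
    (g : E) (hg : ∀ n : ℕ, 1 ≤ n → ∃ η : E, D^[n] η = g) :
    ∃ a b : B, ¬ p ∣ b ∧ g * φ b = φ a := by
  have hφ0 : ∀ b : B, b ≠ 0 → φ b ≠ 0 := fun b hb h => hb (hφ (by rw [h, map_zero]))
  have hξ : φ ξ ≠ 0 := hφ0 _ (fun h => hpξ (h ▸ dvd_zero p))
  have hpp : φ p ≠ 0 := hφ0 _ hp.ne_zero
  have hnd : ∀ b : B, ¬ p ∣ b → φ b ≠ 0 := fun b hb => hφ0 _ (fun h => hb (h ▸ dvd_zero p))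
  have hnat : ∀ k : ℕ, ¬ p ∣ ((k + 1 : ℕ) : B) := by
    intro k h
    have : IsUnit ((k + 1 : ℕ) : B) := by
      have h1 : IsUnit ((k + 1 : ℕ) : C) := IsUnit.mk0 _ (by exact_mod_cast Nat.succ_ne_zero k)
      simpa using h1.map (algebraMap C B)
    exact hp.not_isUnit (isUnit_of_dvd_unit h this)
  have dich : ∀ e : E, (∃ a b : B, ¬ p ∣ b ∧ e * φ b = φ a) ∨
      ∃ (k : ℕ) (a b : B), ¬ p ∣ a ∧ ¬ p ∣ b ∧ e * φ (p ^ (k + 1) * b) = φ a := by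
    intro e
    obtain ⟨a, b, hb, he⟩ := hfrac e
    obtain ⟨a', b', c', hrel, rfl, rfl⟩ := UniqueFactorizationMonoid.exists_reduced_factors' a b hb
    have hc : φ c' ≠ 0 := hφ0 _ (left_ne_zero_of_mul hb)
    have he' : e * φ b' = φ a' := by
      apply mul_left_cancel₀ hc
      rw [map_mul, map_mul] at he
      linear_combination he
    by_cases hpb : p ∣ b'
    · right
      have hpa : ¬ p ∣ a' := fun h => hp.not_isUnit (hrel h hpb)
      obtain ⟨b'', hk, hk'⟩ := (FiniteMultiplicity.of_prime_left hp
        (right_ne_zero_of_mul hb)).exists_eq_pow_mul_and_not_dvd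
      generalize multiplicity p b' = j at hk
      rcases j with _ | k
      · rw [pow_zero, one_mul] at hk
        exact absurd (hk ▸ hpb) hk'
      · exact ⟨k, a', b'', hpa, hk', hk ▸ he'⟩
    · exact Or.inl ⟨a', b', hpb, he'⟩
  have hI : ∀ e : E, (∃ a b : B, ¬ p ∣ b ∧ e * φ b = φ a) →
      (∃ a b : B, ¬ p ∣ b ∧ D e * φ b = φ a) := by
    rintro e ⟨a, b, hb, he⟩
    refine ⟨δ a * b - a * δ b, ξ * b * b, ?_, ?_⟩
    · intro h
      rcases hp.dvd_or_dvd h with h | h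
      · exact (hp.dvd_or_dvd h).elim hpξ hb
      · exact hb h
    · have h1 := congrArg D he
      rw [Derivation.leibniz, smul_eq_mul, smul_eq_mul] at h1
      simp only [map_mul, map_sub, ← hδ]
      linear_combination φ ξ * φ b * h1 - D (φ b) * φ ξ * he
  have hP : ∀ (e : E) (k : ℕ),
      (∃ a b : B, ¬ p ∣ a ∧ ¬ p ∣ b ∧ e * φ (p ^ (k + 1) * b) = φ a) →
      (∃ a b : B, ¬ p ∣ a ∧ ¬ p ∣ b ∧ D e * φ (p ^ (k + 1 + 1) * b) = φ a) := by
    rintro e k ⟨a, b, ha, hb, he⟩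
    refine ⟨δ a * p * b - a * ((k + 1 : ℕ) : B) * δ p * b - a * p * δ b, ξ * b * b, ?_, ?_, ?_⟩
    · intro h
      have h2 : p ∣ a * ((k + 1 : ℕ) : B) * δ p * b := by
        have : a * ((k + 1 : ℕ) : B) * δ p * b = p * (δ a * b - a * δ b) -
          (δ a * p * b - a * ((k + 1 : ℕ) : B) * δ p * b - a * p * δ b) := by ring
        rw [this]
        exact dvd_sub (dvd_mul_right _ _) h
      rcases hp.dvd_or_dvd h2 with h | h
      · rcases hp.dvd_or_dvd h with h | h
        · exact (hp.dvd_or_dvd h).elim ha (hnat k)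
        · exact hpδ h
      · exact hb h
    · intro h
      rcases hp.dvd_or_dvd h with h | h
      · exact (hp.dvd_or_dvd h).elim hpξ hb
      · exact hb h
    · rw [map_mul, map_pow] at he
      have h1 := congrArg D he
      simp only [Derivation.leibniz, Derivation.leibniz_pow, smul_eq_mul, nsmul_eq_mul,
        Nat.add_sub_cancel] at h1
      simp only [map_mul, map_sub, map_pow, ← hδ, map_natCast]
      push_cast at h1 ⊢
      linear_combination φ p * φ ξ * φ b * h1 -
        (D (φ b) * φ ξ * φ p + (k + 1) * φ b * D (φ p) * φ ξ) * he
  have hIn : ∀ (n : ℕ) (e : E), (∃ a b : B, ¬ p ∣ b ∧ e * φ b = φ a) →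
      (∃ a b : B, ¬ p ∣ b ∧ D^[n] e * φ b = φ a) := by
    intro n
    induction n with
    | zero => intro e h; exact h
    | succ n ih => intro e h; exact ih _ (hI _ h)
  have hPn : ∀ (n : ℕ) (e : E) (k : ℕ),
      (∃ a b : B, ¬ p ∣ a ∧ ¬ p ∣ b ∧ e * φ (p ^ (k + 1) * b) = φ a) →
      (∃ a b : B, ¬ p ∣ a ∧ ¬ p ∣ b ∧ D^[n] e * φ (p ^ (k + n + 1) * b) = φ a) := by
    intro n
    induction n with
    | zero => intro e k h; exact h
    | succ n ih =>
      intro e k h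
      have := ih _ (k + 1) (hP _ _ h)
      rwa [show k + 1 + n + 1 = k + (n + 1) + 1 by ring] at this
  rcases dich g with h | ⟨m, a, b, ha, hb, hab⟩
  · exact h
  obtain ⟨η, rfl⟩ := hg (m + 1) (by omega)
  rcases dich η with h | ⟨k, h⟩
  · exact hIn _ _ h
  exfalso
  obtain ⟨a', b', ha', hb', hab'⟩ := hPn (m + 1) _ _ h
  have key : a' * b = a * b' * p ^ (k + 1) := by
    apply hφ
    simp only [map_mul, map_pow] at hab hab' ⊢
    rw [← hab, ← hab']
    ring
  have : p ∣ a' * b := key ▸ (dvd_pow_self p (Nat.succ_ne_zero k)).mul_left _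
  exact (hp.dvd_or_dvd this).elim ha' hb

theorem aux_dvd_pow {B : Type*} [CommRing B] [IsDomain B] [UniqueFactorizationMonoid B]
    (ξ b : B) (hb0 : b ≠ 0) (hb : ∀ p, Prime p → p ∣ b → p ∣ ξ) : ∃ k : ℕ, b ∣ ξ ^ k := by
  induction b using UniqueFactorizationMonoid.induction_on_prime with
  | h₁ => exact absurd rfl hb0
  | h₂ u hu => exact ⟨0, hu.dvd⟩
  | h₃ a p ha hp ih =>
    obtain ⟨k, hk⟩ := ih ha (fun q hq h => hb q hq (h.mul_left _))
    exact ⟨k + 1, by rw [pow_succ']; exact mul_dvd_mul (hb p hp (dvd_mul_right _ _)) hk⟩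

open Polynomial in
theorem aux_inj {C E : Type*} [Field C] [Field E] [Algebra C E] (x L : E)
    (hxtr : Transcendental C x)
    (hLtr : Transcendental (↥(IntermediateField.adjoin C {x})) L) :
    Function.Injective (eval₂RingHom (aeval (R := C) x).toRingHom L) := by
  let K := IntermediateField.adjoin C {x}
  let x' : K := ⟨x, IntermediateField.mem_adjoin_simple_self C x⟩
  have hcomp : (aeval (R := C) x).toRingHom = (algebraMap K E).comp (aeval (R := C) x').toRingHom := by
    ext a
    · simp
    · simp
      rfl
  have hx' : Function.Injective (aeval (R := C) x') := by
    rw [← transcendental_iff_injective]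
    intro h
    exact hxtr (h.algebraMap (A := E))
  rw [injective_iff_map_eq_zero]
  intro b hb
  rw [coe_eval₂RingHom, hcomp, ← eval₂_map] at hb
  have h1 := (transcendental_iff.mp hLtr) _ hb
  exact (Polynomial.map_eq_zero_iff (f := (aeval (R := C) x').toRingHom) hx').mp h1

open Polynomial in
/-- Darboux elements -/
theorem aux_darboux {C E : Type*} [Field C] [Field E] [Algebra C E] [CharZero C]
    (D : Derivation C E E) (x L : E) (hx0 : x ≠ 0) (hx : D x = 1)
    (hconst : ∀ c : E, D c = 0 → ∃ a : C, algebraMap C E a = c)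
    (φ : C[X][X] →+* E) (hφ : φ = eval₂RingHom (aeval (R := C) x).toRingHom L)
    (hinj : Function.Injective φ)
    (δ : C[X][X] → C[X][X]) (hδ : ∀ b, D (φ b) * x = φ (δ b))
    (hcoeff : ∀ b n, (δ b).coeff n = X * derivative (b.coeff n) + ((n : C[X]) + 1) * b.coeff (n + 1))
    (p : C[X][X]) (hp : Prime p) (hpδ : p ∣ δ p) : p ∣ Polynomial.C X := by
  obtain ⟨f, hf⟩ := hpδ
  have hdeg : (δ p).natDegree ≤ p.natDegree := by
    rw [natDegree_le_iff_coeff_eq_zero]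
    intro n hn
    rw [hcoeff, coeff_eq_zero_of_natDegree_lt hn, coeff_eq_zero_of_natDegree_lt (by omega)]
    simp
  have hf0 : f.natDegree = 0 := by
    by_cases h : f = 0
    · simp [h]
    · rw [hf, natDegree_mul hp.ne_zero h] at hdeg
      omega
  obtain ⟨f, rfl⟩ := natDegree_eq_zero.mp hf0
  have hlc := hcoeff p p.natDegree
  rw [hf, coeff_mul_C, coeff_eq_zero_of_natDegree_lt (Nat.lt_succ_self _), mul_zero, add_zero] at hlc
  set a := p.coeff p.natDegree with ha
  have ha0 : a ≠ 0 := by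
    have := leadingCoeff_ne_zero.mpr hp.ne_zero
    exact this
  have hf1 : f.natDegree = 0 := by
    by_cases h : f = 0
    · simp [h]
    · have h1 : (a * f).natDegree ≤ a.natDegree := by
        rw [hlc, natDegree_le_iff_coeff_eq_zero]
        intro n hn
        rcases n with _ | n
        · omega
        · rw [coeff_X_mul, coeff_derivative, coeff_eq_zero_of_natDegree_lt hn, zero_mul]
      rw [natDegree_mul ha0 h] at h1
      omega
  obtain ⟨c, rfl⟩ := natDegree_eq_zero.mp hf1
  have hc : c = (a.natDegree : C) := by
    have h1 := congrArg (fun q => coeff q a.natDegree) hlc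
    simp only [coeff_mul_C] at h1
    have h2 : a.coeff a.natDegree ≠ 0 := leadingCoeff_ne_zero.mpr ha0
    apply mul_left_cancel₀ h2
    rw [h1]
    rcases hn : a.natDegree with _ | n
    · simp
    · rw [coeff_X_mul, coeff_derivative]; push_cast; ring
  set n := a.natDegree
  have hD := hδ p
  have hφC : φ (Polynomial.C (Polynomial.C c)) = (n : E) := by
    rw [hc]; simp
  rw [hf, map_mul, hφC] at hD
  obtain ⟨u, hu⟩ := hconst (φ p / x ^ n) (by
    rw [Derivation.leibniz_div, Derivation.leibniz_pow, hx]
    have : x ^ n * D (φ p) = φ p * (n * x ^ (n - 1)) := by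
      rcases n with _ | m
      · simp at hD ⊢; exact hD.resolve_right hx0
      · simp only [Nat.add_sub_cancel, pow_succ]
        linear_combination x ^ m * hD
    simp [this])
  have hu' : p = Polynomial.C (Polynomial.C u) * (Polynomial.C X) ^ n := by
    apply hinj
    have h3 : φ (Polynomial.C X) = x := by rw [hφ]; simp
    have h4 : φ (Polynomial.C (Polynomial.C u)) = algebraMap C E u := by rw [hφ]; simp
    rw [map_mul, map_pow, h3, h4, hu]
    field_simp
  have hu0 : u ≠ 0 := by
    rintro rfl
    apply hp.ne_zero
    rw [hu']; simp
  have hun : IsUnit (Polynomial.C (Polynomial.C u)) := ((IsUnit.mk0 u hu0).map Polynomial.C).map Polynomial.C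
  have hdvd : p ∣ Polynomial.C (Polynomial.C u) * (Polynomial.C X) ^ n := hu' ▸ dvd_rfl
  rcases hp.dvd_or_dvd hdvd with h | h
  · exact absurd (isUnit_of_dvd_unit h hun) hp.not_isUnit
  · exact hp.dvd_of_dvd_pow h

open Polynomial in
theorem aux_frac {C E : Type*} [Field C] [Field E] [Algebra C E]
    (x L : E) (φ : C[X][X] →+* E) (hφ : φ = eval₂RingHom (aeval (R := C) x).toRingHom L)
    (hinj : Function.Injective φ)
    (hgen : IntermediateField.adjoin C {x, L} = ⊤) (e : E) :
    ∃ a b : C[X][X], b ≠ 0 ∧ e * φ b = φ a := by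
  have he : e ∈ IntermediateField.adjoin C {x, L} := hgen ▸ IntermediateField.mem_top
  induction he using IntermediateField.adjoin_induction with
  | mem y hy =>
    rcases hy with rfl | hy
    · exact ⟨Polynomial.C X, 1, one_ne_zero, by rw [hφ]; simp⟩
    · rw [Set.mem_singleton_iff] at hy
      subst hy
      exact ⟨X, 1, one_ne_zero, by rw [hφ]; simp⟩
  | algebraMap c => exact ⟨Polynomial.C (Polynomial.C c), 1, one_ne_zero, by rw [hφ]; simp⟩
  | add y z _ _ hy hz =>
    obtain ⟨a, b, hb, h⟩ := hy
    obtain ⟨a', b', hb', h'⟩ := hz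
    refine ⟨a * b' + a' * b, b * b', mul_ne_zero hb hb', ?_⟩
    simp only [map_add, map_mul, ← h, ← h']; ring
  | mul y z _ _ hy hz =>
    obtain ⟨a, b, hb, h⟩ := hy
    obtain ⟨a', b', hb', h'⟩ := hz
    refine ⟨a * a', b * b', mul_ne_zero hb hb', ?_⟩
    simp only [map_mul, ← h, ← h']; ring
  | inv y _ hy =>
    obtain ⟨a, b, hb, h⟩ := hy
    by_cases hy0 : y = 0
    · exact ⟨0, 1, one_ne_zero, by simp [hy0]⟩
    · refine ⟨b, a, ?_, ?_⟩
      · rintro rfl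
        rw [map_zero] at h
        rcases mul_eq_zero.mp h with h | h
        · exact hy0 h
        · exact hb (hinj (by rw [h, map_zero]))
      · rw [← h]; field_simp

/-- antiderivatives of `x ^ m * L ^ k` -/
theorem aux_anti {C E : Type*} [Field C] [Field E] [Algebra C E] [CharZero C]
    (D : Derivation C E E) (x L : E) (hx0 : x ≠ 0) (hx : D x = 1) (hL : D L = x⁻¹)
    (M : Submodule C E) (hM : M = Submodule.span C {e | ∃ (m : ℤ) (k : ℕ), e = x ^ m * L ^ k})
    (g : E) (hg : g ∈ M) : ∃ η ∈ M, D η = g := by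
  have hmem : ∀ (m : ℤ) (k : ℕ), x ^ m * L ^ k ∈ M := fun m k => by
    rw [hM]; exact Submodule.subset_span ⟨m, k, rfl⟩
  have hE : CharZero E := charZero_of_injective_algebraMap (algebraMap C E).injective
  have hD : ∀ (m : ℤ) (k : ℕ), D (x ^ (m + 1) * L ^ k) =
      ((m : E) + 1) * (x ^ m * L ^ k) + (k : E) * (x ^ m * L ^ (k - 1)) := by
    intro m k
    rw [Derivation.leibniz, Derivation.leibniz_pow, Derivation.leibniz_zpow, hx, hL]
    simp only [smul_eq_mul, nsmul_eq_mul, zsmul_eq_mul, add_sub_cancel_right, zpow_add_one₀ hx0]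
    push_cast
    field_simp
    ring
  have hbase : ∀ (k : ℕ) (m : ℤ), ∃ η ∈ M, D η = x ^ m * L ^ k := by
    intro k
    induction k with
    | zero =>
      intro m
      by_cases hm : (m : C) + 1 = 0
      · have hm' : m = -1 := by
          have : ((m + 1 : ℤ) : C) = 0 := by push_cast; exact hm
          have := Int.cast_eq_zero.mp this
          omega
        subst hm'
        exact ⟨L, by simpa using hmem 0 1, by simp [hL]⟩
      · refine ⟨((m : C) + 1)⁻¹ • (x ^ (m + 1) * L ^ 0), M.smul_mem _ (hmem _ _), ?_⟩
        rw [Derivation.map_smul, hD]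
        rw [inv_smul_eq_iff₀ hm, Algebra.smul_def]
        simp
    | succ k ih =>
      intro m
      by_cases hm : (m : C) + 1 = 0
      · have hm' : m = -1 := by
          have : ((m + 1 : ℤ) : C) = 0 := by push_cast; exact hm
          have := Int.cast_eq_zero.mp this
          omega
        subst hm'
        have hk : ((k : C) + 1 + 1) ≠ 0 := by exact_mod_cast Nat.succ_ne_zero (k + 1)
        refine ⟨((k : C) + 1 + 1)⁻¹ • (x ^ (0 : ℤ) * L ^ (k + 1 + 1)), M.smul_mem _ (hmem _ _), ?_⟩
        have := hD (-1) (k + 1 + 1)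
        rw [neg_add_cancel] at this
        rw [Derivation.map_smul, this, inv_smul_eq_iff₀ hk, Algebra.smul_def]
        simp
      · obtain ⟨η, hη, hη'⟩ := ih m
        refine ⟨((m : C) + 1)⁻¹ • (x ^ (m + 1) * L ^ (k + 1) - ((k : C) + 1) • η),
          M.smul_mem _ (M.sub_mem (hmem _ _) (M.smul_mem _ hη)), ?_⟩
        rw [Derivation.map_smul, map_sub, hD, Derivation.map_smul, hη']
        rw [inv_smul_eq_iff₀ hm, Algebra.smul_def, Algebra.smul_def]
        simp
  rw [hM] at hg
  induction hg using Submodule.span_induction with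
  | mem e he => obtain ⟨m, k, rfl⟩ := he; exact hbase k m
  | zero => exact ⟨0, M.zero_mem, map_zero _⟩
  | add y z _ _ hy hz =>
    obtain ⟨a, ha, rfl⟩ := hy
    obtain ⟨b, hb, rfl⟩ := hz
    exact ⟨a + b, M.add_mem ha hb, map_add _ _ _⟩
  | smul c y _ hy =>
    obtain ⟨a, ha, rfl⟩ := hy
    exact ⟨c • a, M.smul_mem _ ha, Derivation.map_smul _ _ _⟩

theorem aux_laurent {C E : Type*} [Field C] [Field E] [Algebra C E]
    (x L : E) (hx0 : x ≠ 0) (f : E) (hf : f ∈ Algebra.adjoin C {x, x⁻¹}) :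
    ∀ k : ℕ, f * L ^ k ∈ Submodule.span C {e | ∃ (m : ℤ) (k : ℕ), e = x ^ m * L ^ k} := by
  intro k
  have : ∀ y ∈ Submodule.span C {e | ∃ (m : ℤ) (k : ℕ), e = x ^ m * L ^ k},
      f * y ∈ Submodule.span C {e | ∃ (m : ℤ) (k : ℕ), e = x ^ m * L ^ k} := by
    have hz : ∀ (n : ℤ), ∀ y ∈ Submodule.span C {e | ∃ (m : ℤ) (k : ℕ), e = x ^ m * L ^ k},
      x ^ n * y ∈ Submodule.span C {e | ∃ (m : ℤ) (k : ℕ), e = x ^ m * L ^ k} := by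
      intro n y hy
      induction hy using Submodule.span_induction with
      | mem e he =>
        obtain ⟨m, k, rfl⟩ := he
        exact Submodule.subset_span ⟨n + m, k, by rw [zpow_add₀ hx0]; ring⟩
      | zero => simp
      | add y z _ _ hy hz => rw [mul_add]; exact Submodule.add_mem _ hy hz
      | smul c y _ hy => rw [mul_smul_comm]; exact Submodule.smul_mem _ _ hy
    induction hf using Algebra.adjoin_induction with
    | mem e he =>
      rcases he with rfl | he
      · simpa using hz 1
      · rw [Set.mem_singleton_iff] at he
        subst he
        simpa using hz (-1)
    | algebraMap c =>
      intro y hy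
      rw [← Algebra.smul_def]
      exact Submodule.smul_mem _ _ hy
    | add a b _ _ ha hb =>
      intro y hy
      rw [add_mul]
      exact Submodule.add_mem _ (ha y hy) (hb y hy)
    | mul a b _ _ ha hb =>
      intro y hy
      rw [mul_assoc]
      exact ha _ (hb y hy)
  exact this _ (Submodule.subset_span ⟨0, k, by simp⟩)

theorem aux_den {C E B : Type*} [Field C] [Field E] [Algebra C E] [CharZero C]
    [CommRing B] [IsDomain B] [Algebra C B] [UniqueFactorizationMonoid B]
    (D : Derivation C E E) (φ : B →+* E) (hinj : Function.Injective φ)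
    (hfrac : ∀ e : E, ∃ a b : B, b ≠ 0 ∧ e * φ b = φ a)
    (ξ : B) (δ : B → B) (hδ : ∀ b, D (φ b) * φ ξ = φ (δ b))
    (hdar : ∀ p : B, Prime p → ¬ p ∣ ξ → ¬ p ∣ δ p)
    (g : E) (hg : ∀ n : ℕ, 1 ≤ n → ∃ η : E, D^[n] η = g) :
    ∃ (k : ℕ) (a : B), g * φ ξ ^ k = φ a := by
  obtain ⟨a, b, hb, hab⟩ := hfrac g
  obtain ⟨a', b', c', hrel, rfl, rfl⟩ := UniqueFactorizationMonoid.exists_reduced_factors' a b hb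
  have hc : φ c' ≠ 0 := fun h => left_ne_zero_of_mul hb (hinj (by rw [h, map_zero]))
  have hb' := right_ne_zero_of_mul hb
  have hab' : g * φ b' = φ a' := by
    apply mul_left_cancel₀ hc
    rw [map_mul, map_mul] at hab
    linear_combination hab
  have hprime : ∀ p, Prime p → p ∣ b' → p ∣ ξ := by
    intro p hp hpb
    by_contra hpX
    obtain ⟨a, b, hpb', h⟩ := aux_pole D φ hinj hfrac ξ δ hδ p hp hpX (hdar p hp hpX) g hg
    have key : a' * b = a * b' := by
      apply hinj
      rw [map_mul, map_mul, ← h, ← hab']; ring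
    have h1 : p ∣ a' * b := key ▸ hpb.mul_left _
    rcases hp.dvd_or_dvd h1 with h1 | h1
    · exact hp.not_isUnit (hrel h1 hpb)
    · exact hpb' h1
  obtain ⟨k, d, hk⟩ := aux_dvd_pow ξ b' hb' hprime
  refine ⟨k, a' * d, ?_⟩
  have hk' := congrArg φ hk
  rw [map_pow, map_mul] at hk'
  rw [hk', map_mul, ← hab']
  ring

/-- in `E = C(x, log x)` (with `x' = 1`, `L' = 1/x`, `L`
transcendental over `C(x)`, constants `C`), an element `g` is ∞-integrable iff
`g = Σ_{i=0}^{n} f_i·Lⁱ` with `f_i ∈ C[x, x⁻¹]`. -/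
theorem stmt_15 (C E : Type*) [Field C] [Field E] [Algebra C E]
    [CharZero C] [IsAlgClosed C]
    (D : E → E)
    (hadd : ∀ a b : E, D (a + b) = D a + D b)
    (hmul : ∀ a b : E, D (a * b) = a * D b + D a * b)
    (hCc : ∀ c : C, D (algebraMap C E c) = 0)
    (x L : E) (hx : D x = 1) (hL : D L = x⁻¹)
    (hxtr : Transcendental C x)
    (hLtr : Transcendental (↥(IntermediateField.adjoin C {x})) L)
    (hgen : IntermediateField.adjoin C {x, L} = ⊤)
    (hconst : ∀ c : E, D c = 0 → ∃ a : C, algebraMap C E a = c)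
    (g : E) :
    (∀ n : ℕ, 1 ≤ n → ∃ η : E, D^[n] η = g) ↔
      ∃ (n : ℕ) (f : ℕ → E),
        (∀ i, f i ∈ Algebra.adjoin C {x, x⁻¹}) ∧
        g = ∑ i ∈ Finset.range (n + 1), f i * L ^ i := by
  have hx0 : x ≠ 0 := by
    rintro rfl
    exact hxtr isAlgebraic_zero
  obtain ⟨D', hD'⟩ : ∃ D' : Derivation C E E, ∀ a, D' a = D a := by
    refine ⟨Derivation.mk' { toFun := D, map_add' := hadd, map_smul' := ?_ } ?_, fun a => rfl⟩
    · intro c a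
      rw [Algebra.smul_def, hmul, hCc, Algebra.smul_def]; simp
    · intro a b
      simp only [LinearMap.coe_mk, AddHom.coe_mk, smul_eq_mul, hmul]; ring
  obtain rfl : ⇑D' = D := funext hD'
  constructor
  · intro hg
    choose δ hδ hcoeff using aux_delta D' x L hx0 hx hL
    have hinj := aux_inj x L hxtr hLtr
    have hfrac := aux_frac x L _ rfl hinj hgen
    set φ := Polynomial.eval₂RingHom (Polynomial.aeval (R := C) x).toRingHom L with hφ
    have hφX : φ (Polynomial.C Polynomial.X) = x := by rw [hφ]; simp
    have hδ' : ∀ b, D' (φ b) * x = φ (δ b) := hδ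
    clear_value φ
    have hδ'' : ∀ b, D' (φ b) * φ (Polynomial.C Polynomial.X) = φ (δ b) := by
      intro b; rw [hφX]; exact hδ' b
    have hdar : ∀ p, Prime p → ¬ p ∣ Polynomial.C Polynomial.X → ¬ p ∣ δ p := fun p hp hpX h =>
      hpX (aux_darboux D' x L hx0 hx hconst φ hφ hinj δ hδ' hcoeff p hp h)
    obtain ⟨k, q, hg'⟩ := aux_den D' φ hinj hfrac (Polynomial.C Polynomial.X) δ hδ'' hdar g hg
    rw [hφX] at hg'
    refine ⟨q.natDegree, fun i => Polynomial.aeval x (q.coeff i) * x⁻¹ ^ k, ?_, ?_⟩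
    · intro i
      refine mul_mem ?_ (pow_mem (Algebra.subset_adjoin (by simp)) _)
      exact Algebra.adjoin_mono (by simp) (Polynomial.aeval_mem_adjoin_singleton C x)
    · have : g = φ q * x⁻¹ ^ k := by
        rw [← hg', mul_assoc, ← mul_pow, mul_inv_cancel₀ hx0, one_pow, mul_one]
      rw [this, hφ, Polynomial.coe_eval₂RingHom, Polynomial.eval₂_eq_sum_range, Finset.sum_mul]
      refine Finset.sum_congr rfl fun i _ => ?_
      simp only [AlgHom.toRingHom_eq_coe, RingHom.coe_coe]
      ring
  · rintro ⟨n, f, hf, rfl⟩ N -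
    have hmem := Submodule.sum_mem
      (Submodule.span C {e | ∃ (m : ℤ) (k : ℕ), e = x ^ m * L ^ k})
      (fun i (_ : i ∈ Finset.range (n + 1)) => aux_laurent x L hx0 (f i) (hf i) i)
    generalize ∑ i ∈ Finset.range (n + 1), f i * L ^ i = g at hmem
    have : ∀ (N : ℕ) (g : E), g ∈ Submodule.span C {e | ∃ (m : ℤ) (k : ℕ), e = x ^ m * L ^ k} →
        ∃ η : E, D'^[N] η = g := by
      intro N
      induction N with
      | zero => intro g _; exact ⟨g, rfl⟩
      | succ N ih =>
        intro g hg
        obtain ⟨η, hη, h⟩ := aux_anti D' x L hx0 hx hL _ rfl g hg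
        obtain ⟨ζ, hζ⟩ := ih η hη
        exact ⟨ζ, by rw [Function.iterate_succ_apply', hζ, h]⟩
    exact this N g hmem
end

section
/- Let C be an algebraically closed field of characteristic zero, n ≥ 2 an integer, and let E = C(t) with the derivation determined by (t^n)' = 1, i.e. t' = 1/(n·t^{n-1}), so that E ≅ C(x^{1/n}) where x = t^n and x' = 1. Write each g ∈ E uniquely as g = Σ_{i=0}^{n-1} f_i·t^i with f_i ∈ C(x). Then g is ∞-integrable in E if and only if f_0 ∈ C[x] and f_i ∈ C[x, x^{-1}] for all 1 ≤ i ≤ n−1. -/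
namespace S16
open Polynomial
variable {C E : Type*} [Field C] [Field E] [Algebra C E]

def Reg (t : E) (a : C) (e : E) : Prop :=
  ∃ p q : C[X], q.eval a ≠ 0 ∧ e = aeval t p / aeval t q

def Pole (t : E) (a : C) (k : ℕ) (e : E) : Prop :=
  ∃ p q : C[X], p.eval a ≠ 0 ∧ q.eval a ≠ 0 ∧ e = aeval t p / (aeval t q * (aeval t (X - Polynomial.C a)) ^ k)

theorem ev_ne {t : E} (ht : Transcendental C t) {p : C[X]} (hp : p ≠ 0) : aeval t p ≠ 0 := by
  intro h
  exact hp ((transcendental_iff.mp ht) p h)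

theorem ne_of_eval {a : C} {p : C[X]} (h : p.eval a ≠ 0) : p ≠ 0 := by
  rintro rfl; simp at h

theorem Pole.not_lt {t : E} (ht : Transcendental C t) {a : C} {k k' : ℕ} (hk : k' < k) {e : E}
    (h : Pole t a k e) (p' q' : C[X]) (hq' : q'.eval a ≠ 0)
    (he : e = aeval t p' / (aeval t q' * (aeval t (X - Polynomial.C a)) ^ k')) : False := by
  obtain ⟨p, q, hp, hq, h⟩ := h
  obtain ⟨d, rfl⟩ := Nat.exists_eq_add_of_lt hk
  have h1 := ev_ne ht (ne_of_eval hq)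
  have h2 := ev_ne ht (ne_of_eval hq')
  have h3 := ev_ne ht (X_sub_C_ne_zero a)
  rw [h, div_eq_div_iff (by positivity) (by positivity)] at he
  have h4 : aeval t (p * q' - p' * q * (X - Polynomial.C a) ^ (d + 1)) = 0 := by
    have h5 : aeval t (X - Polynomial.C a) ^ k' ≠ 0 := pow_ne_zero _ h3
    rw [map_sub, map_mul, map_mul, map_mul, map_pow]
    apply mul_right_cancel₀ h5
    linear_combination he
  have h6 := congrArg (eval a) ((transcendental_iff.mp ht) _ h4)
  simp at h6
  tauto

theorem Reg_or_Pole {t : E} (ht : Transcendental C t)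
    (hgen : IntermediateField.adjoin C {t} = ⊤) (a : C) (e : E) :
    Reg t a e ∨ ∃ k, 1 ≤ k ∧ Pole t a k e := by
  have he : e ∈ IntermediateField.adjoin C {t} := by rw [hgen]; trivial
  obtain ⟨p, q, rfl⟩ := (IntermediateField.mem_adjoin_simple_iff C e).mp he
  by_cases hp : p = 0
  · left; exact ⟨0, 1, by simp, by simp [hp]⟩
  by_cases hq : q = 0
  · left; exact ⟨0, 1, by simp, by simp [hq]⟩
  obtain ⟨p1, hp1, hp2⟩ := exists_eq_pow_rootMultiplicity_mul_and_not_dvd p hp a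
  obtain ⟨q1, hq1, hq2⟩ := exists_eq_pow_rootMultiplicity_mul_and_not_dvd q hq a
  rw [dvd_iff_isRoot, IsRoot.def] at hp2 hq2
  generalize rootMultiplicity a p = r at hp1
  generalize rootMultiplicity a q = s at hq1
  subst hp1 hq1
  have h1 := ev_ne ht (ne_of_eval hq2)
  have h3 := ev_ne ht (X_sub_C_ne_zero a)
  rcases le_or_gt s r with h | h
  · obtain ⟨d, rfl⟩ := Nat.exists_eq_add_of_le h
    left
    refine ⟨(X - Polynomial.C a) ^ d * p1, q1, hq2, ?_⟩
    simp only [map_mul, map_pow]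
    rw [div_eq_div_iff (by positivity) h1]
    ring
  · obtain ⟨d, rfl⟩ := Nat.exists_eq_add_of_lt h
    right
    refine ⟨d + 1, by omega, p1, q1, hp2, hq2, ?_⟩
    simp only [map_mul, map_pow]
    rw [div_eq_div_iff (by positivity) (by positivity)]
    ring

theorem mem_span_of_reg [IsAlgClosed C] {t : E} (ht : Transcendental C t)
    (hgen : IntermediateField.adjoin C {t} = ⊤) (e : E) (h : ∀ a : C, a ≠ 0 → Reg t a e) :
    e ∈ Submodule.span C (Set.range fun k : ℤ => t ^ k) := by
  have he : e ∈ IntermediateField.adjoin C {t} := by rw [hgen]; trivial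
  obtain ⟨p, q, hpq⟩ := (IntermediateField.mem_adjoin_simple_iff C e).mp he
  have t0 : t ≠ 0 := by
    have := ev_ne ht (X_ne_zero (R := C)); simpa using this
  by_cases hq : q = 0
  · rw [hpq, hq]; simp
  classical
  obtain ⟨P, Q, hPQ, hQ, hcop⟩ : ∃ P Q : C[X], e = aeval t P / aeval t Q ∧ Q ≠ 0 ∧ IsCoprime P Q := by
    obtain ⟨P, hP⟩ := EuclideanDomain.gcd_dvd_left p q
    obtain ⟨Q, hQ⟩ := EuclideanDomain.gcd_dvd_right p q
    have hab := EuclideanDomain.gcd_eq_gcd_ab p q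
    have hg : EuclideanDomain.gcd p q ≠ 0 := by
      intro h0; exact hq (EuclideanDomain.gcd_eq_zero_iff.mp h0).2
    generalize EuclideanDomain.gcdA p q = A at hab
    generalize EuclideanDomain.gcdB p q = B at hab
    generalize EuclideanDomain.gcd p q = G at *
    have hQ0 : Q ≠ 0 := by rintro rfl; exact hq (by simpa using hQ)
    have h1 := ev_ne ht hg
    have h2 := ev_ne ht hQ0
    refine ⟨P, Q, ?_, hQ0, ?_⟩
    · rw [hpq, hP, hQ]
      rw [map_mul, map_mul, mul_div_mul_left _ _ h1]
    · refine ⟨A, B, mul_left_cancel₀ hg ?_⟩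
      rw [hP, hQ] at hab
      linear_combination -hab
  obtain ⟨q1, hq1, hq2⟩ := exists_eq_pow_rootMultiplicity_mul_and_not_dvd Q hQ 0
  rw [dvd_iff_isRoot, IsRoot.def] at hq2
  generalize rootMultiplicity 0 Q = r at hq1
  have hdeg : q1.degree = 0 := by
    by_contra hd
    obtain ⟨a, ha⟩ := IsAlgClosed.exists_root q1 hd
    have ha0 : a ≠ 0 := by rintro rfl; exact hq2 ha
    obtain ⟨p', q', hq', h'⟩ := h a ha0
    have h1 := ev_ne ht hQ
    have h2 := ev_ne ht (ne_of_eval hq')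
    rw [hPQ, div_eq_div_iff h1 h2] at h'
    have h4 : aeval t (P * q' - p' * Q) = 0 := by simp [h']
    have h6 := congrArg (eval a) ((transcendental_iff.mp ht) _ h4)
    have hQa : eval a Q = 0 := by rw [hq1, eval_mul, ha.eq_zero, mul_zero]
    have hPa : eval a P = 0 := by
      simp [hQa] at h6; tauto
    obtain ⟨u, v, huv⟩ := hcop
    have := congrArg (eval a) huv
    simp [hQa, hPa] at this
  obtain ⟨c, rfl⟩ : ∃ c, q1 = Polynomial.C c := ⟨_, eq_C_of_degree_eq_zero hdeg⟩
  have : e = c⁻¹ • (P.sum fun k b => b • t ^ ((k : ℤ) - r)) := by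
    rw [hPQ, hq1, aeval_eq_sum_range, Polynomial.sum_over_range _ (by simp), Finset.smul_sum, Finset.sum_div]
    apply Finset.sum_congr rfl
    intro i _
    simp only [Algebra.smul_def, map_inv₀, map_mul, map_pow, aeval_X, aeval_C, map_zero, sub_zero]
    rw [zpow_sub₀ t0, zpow_natCast, zpow_natCast]
    field_simp
  rw [this]
  refine Submodule.smul_mem _ _ (Submodule.sum_mem _ fun i _ => Submodule.smul_mem _ _ (Submodule.subset_span ⟨_, rfl⟩))

theorem linInd {t : E} (ht : Transcendental C t) : LinearIndependent C (fun k : ℤ => t ^ k) := by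
  have t0 : t ≠ 0 := by
    have := ev_ne ht (X_ne_zero (R := C)); simpa using this
  rw [linearIndependent_iff']
  intro s c hs k hk
  obtain ⟨N, hN⟩ : ∃ N : ℕ, ∀ k ∈ s, 0 ≤ k + N := by
    refine ⟨∑ k ∈ s, k.natAbs, fun k hk => ?_⟩
    have := Finset.single_le_sum (f := fun k : ℤ => k.natAbs) (fun _ _ => Nat.zero_le _) hk
    omega
  have h4 : aeval t (∑ k ∈ s, monomial (k + N).toNat (c k)) = 0 := by
    rw [map_sum, ← zero_mul (t ^ (N : ℤ)), ← hs, Finset.sum_mul]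
    apply Finset.sum_congr rfl
    intro k hk
    rw [aeval_monomial, Algebra.smul_def, mul_assoc, ← zpow_add₀ t0, ← zpow_natCast, Int.toNat_of_nonneg (hN k hk)]
  have h6 := congrArg (fun P => coeff P (k + N).toNat) ((transcendental_iff.mp ht) _ h4)
  simp only [finsetSum_coeff, coeff_monomial, coeff_zero] at h6
  rw [Finset.sum_eq_single k] at h6
  · simpa using h6
  · intro b hb hbk
    rw [if_neg]
    have := hN k hk
    have := hN b hb
    omega
  · tauto

theorem uniq {t : E} (ht : Transcendental C t) {n : ℕ} (hn : n ≠ 0) (e : Fin n → E)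
    (he : ∀ i, e i ∈ IntermediateField.adjoin C {t ^ n}) (h0 : ∑ i, e i * t ^ (i : ℕ) = 0) :
    ∀ i, e i = 0 := by
  have hx : ∀ p : C[X], aeval (t ^ n) p = aeval t (expand C n p) := by
    intro p; rw [expand_aeval]
  have : ∀ i, ∃ p q : C[X], q ≠ 0 ∧ e i * aeval (t ^ n) q = aeval (t ^ n) p := by
    intro i
    obtain ⟨p, q, h⟩ := (IntermediateField.mem_adjoin_simple_iff C _).mp (he i)
    by_cases hq : q = 0
    · exact ⟨0, 1, one_ne_zero, by simp [h, hq]⟩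
    · refine ⟨p, q, hq, ?_⟩
      have : aeval (t ^ n) q ≠ 0 := by
        rw [hx]; exact ev_ne ht ((expand_ne_zero (Nat.pos_of_ne_zero hn)).mpr hq)
      rw [h]; field_simp
  choose p q hq hpq using this
  classical
  let r : Fin n → C[X] := fun i => p i * ∏ j ∈ Finset.univ.erase i, q j
  have hr : ∀ i, e i * aeval (t ^ n) (∏ j, q j) = aeval (t ^ n) (r i) := by
    intro i
    rw [← Finset.mul_prod_erase _ _ (Finset.mem_univ i), map_mul, ← mul_assoc, hpq, ← map_mul]
  have h4 : aeval t (∑ i : Fin n, expand C n (r i) * X ^ (i : ℕ)) = 0 := by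
    rw [map_sum, ← zero_mul (aeval (t ^ n) (∏ j, q j)), ← h0, Finset.sum_mul]
    apply Finset.sum_congr rfl
    intro i _
    rw [map_mul, ← hx, ← hr]; simp; ring
  have h5 := (transcendental_iff.mp ht) _ h4
  have hr0 : ∀ i, r i = 0 := by
    intro i
    ext m
    have h6 := congrArg (fun P => coeff P (m * n + i)) h5
    simp only [finsetSum_coeff, coeff_mul_X_pow', coeff_zero] at h6
    rw [Finset.sum_eq_single i] at h6
    · rw [if_pos (by omega), Nat.add_sub_cancel, coeff_expand_mul (Nat.pos_of_ne_zero hn)] at h6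
      simpa using h6
    · intro b _ hb
      split_ifs with hle
      · rw [coeff_expand (Nat.pos_of_ne_zero hn), if_neg]
        intro hd
        apply hb
        have h7 : (b : ℕ) ≡ m * n + i [MOD n] := (Nat.modEq_iff_dvd' hle).mpr hd
        have h8 : m * n + i ≡ i [MOD n] := by simp [Nat.ModEq]
        have h9 := h7.trans h8
        exact Fin.ext (Nat.ModEq.eq_of_lt_of_lt h9 b.2 i.2)
      · rfl
    · simp
  intro i
  have h10 := hr i
  rw [hr0, map_zero] at h10
  have : aeval (t ^ n) (∏ j, q j) ≠ 0 := by
    rw [hx]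
    exact ev_ne ht ((expand_ne_zero (Nat.pos_of_ne_zero hn)).mpr (Finset.prod_ne_zero_iff.mpr fun j _ => hq j))
  exact (mul_eq_zero.mp h10).resolve_right this

section der
variable (d : Derivation C E E) {t : E} {n : ℕ}

theorem der_t (hd : d (t ^ n) = 1) : (n : E) * t ^ (n - 1) * d t = 1 := by
  rw [Derivation.leibniz_pow] at hd
  simpa [mul_assoc] using hd

theorem der_aeval [CharZero C] (hn : n ≠ 0) (hd : d (t ^ n) = 1) (p : C[X]) :
    d (aeval t p) = aeval t (derivative p) / aeval t ((n : C[X]) * X ^ (n - 1)) := by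
  have h := der_t d hd
  rw [Derivation.map_aeval, smul_eq_mul]
  have h2 : aeval t ((n : C[X]) * X ^ (n - 1)) = (n : E) * t ^ (n - 1) := by simp
  rw [h2, eq_div_iff (left_ne_zero_of_mul_eq_one h), mul_assoc, mul_comm (d t), h, mul_one]

theorem der_div (a b : E) (hb : b ≠ 0) : d (a / b) = (d a * b - a * d b) / b ^ 2 := by
  have h : d ((a / b) * b) = d a := by rw [div_mul_cancel₀ _ hb]
  rw [Derivation.leibniz, smul_eq_mul, smul_eq_mul] at h
  rw [← h]
  field_simp
  ring

theorem eval_ne [CharZero C] (hn : n ≠ 0) {a : C} (ha : a ≠ 0) : eval a ((n : C[X]) * X ^ (n - 1)) ≠ 0 := by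
  simp [hn, ha]

theorem Reg.der [CharZero C] (ht : Transcendental C t) (hn : n ≠ 0) (hd : d (t ^ n) = 1) {a : C} (ha : a ≠ 0)
    {e : E} (h : Reg t a e) : Reg t a (d e) := by
  obtain ⟨p, q, hq, rfl⟩ := h
  have hw := eval_ne (C := C) hn ha
  have h1 := ev_ne ht (ne_of_eval hq)
  have h2 := ev_ne ht (ne_of_eval hw)
  refine ⟨derivative p * q - p * derivative q, q ^ 2 * ((n : C[X]) * X ^ (n - 1)), ?_, ?_⟩
  · rw [eval_mul, eval_pow]; exact mul_ne_zero (pow_ne_zero _ hq) hw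
  · rw [der_div d _ _ h1, der_aeval d hn hd, der_aeval d hn hd]
    generalize (n : C[X]) * X ^ (n - 1) = w at *
    simp only [map_mul, map_sub, map_pow]
    field_simp

theorem Pole.der [CharZero C] (ht : Transcendental C t) (hn : n ≠ 0) (hd : d (t ^ n) = 1) {a : C} (ha : a ≠ 0)
    {k : ℕ} (hk : 1 ≤ k) {e : E} (h : Pole t a k e) : Pole t a (k + 1) (d e) := by
  obtain ⟨p, q, hp, hq, rfl⟩ := h
  have hw := eval_ne (C := C) hn ha
  have h1 := ev_ne ht (ne_of_eval hq)
  have h2 := ev_ne ht (ne_of_eval hw)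
  have h3 := ev_ne ht (X_sub_C_ne_zero a)
  obtain ⟨k, rfl⟩ := Nat.exists_eq_add_of_le' hk
  refine ⟨(X - Polynomial.C a) * (derivative p * q - p * derivative q) - ((k + 1 : ℕ) : C[X]) * p * q,
    q ^ 2 * ((n : C[X]) * X ^ (n - 1)), ?_, ?_, ?_⟩
  · have : (k : C) + 1 ≠ 0 := by exact_mod_cast k.succ_ne_zero
    simp [hp, hq, this]
  · rw [eval_mul, eval_pow]; exact mul_ne_zero (pow_ne_zero _ hq) hw
  · rw [← map_pow, ← map_mul, der_div d _ _ (by rw [map_mul, map_pow]; positivity), der_aeval d hn hd, der_aeval d hn hd]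
    generalize (n : C[X]) * X ^ (n - 1) = w at *
    rw [derivative_mul, derivative_X_sub_C_pow]
    generalize X - Polynomial.C a = u at *
    simp only [map_mul, map_sub, map_pow, map_add, map_natCast, Nat.add_sub_cancel]
    field_simp
    ring

theorem Reg.iter [CharZero C] (ht : Transcendental C t) (hn : n ≠ 0) (hd : d (t ^ n) = 1) {a : C} (ha : a ≠ 0)
    {e : E} (h : Reg t a e) (j : ℕ) : Reg t a (d^[j] e) := by
  induction j with
  | zero => exact h
  | succ j ih => rw [Function.iterate_succ_apply']; exact ih.der d ht hn hd ha

theorem Pole.iter [CharZero C] (ht : Transcendental C t) (hn : n ≠ 0) (hd : d (t ^ n) = 1) {a : C} (ha : a ≠ 0)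
    {k : ℕ} (hk : 1 ≤ k) {e : E} (h : Pole t a k e) (j : ℕ) : Pole t a (k + j) (d^[j] e) := by
  induction j with
  | zero => exact h
  | succ j ih => rw [Function.iterate_succ_apply']; exact ih.der d ht hn hd ha (by omega)

theorem Pole.not_reg (ht : Transcendental C t) {a : C} {k : ℕ} (hk : 1 ≤ k) {e : E}
    (h : Pole t a k e) (h' : Reg t a e) : False := by
  obtain ⟨p, q, hq, he⟩ := h'
  exact h.not_lt ht hk p q hq (by simpa using he)

theorem reg_of_int [CharZero C] (ht : Transcendental C t) (hgen : IntermediateField.adjoin C {t} = ⊤)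
    (hn : n ≠ 0) (hd : d (t ^ n) = 1) {a : C} (ha : a ≠ 0)
    {g : E} (h : ∀ j : ℕ, 1 ≤ j → ∃ η : E, d^[j] η = g) : Reg t a g := by
  rcases Reg_or_Pole ht hgen a g with h1 | ⟨m, hm, h1⟩
  · exact h1
  exfalso
  obtain ⟨η, hη⟩ := h m hm
  rcases Reg_or_Pole ht hgen a η with h2 | ⟨k, hk, h2⟩
  · exact h1.not_reg ht hm (hη ▸ h2.iter d ht hn hd ha m)
  · have h3 := h2.iter d ht hn hd ha hk m
    rw [hη] at h3
    obtain ⟨p, q, hp, hq, he⟩ := h1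
    exact h3.not_lt ht (by omega) p q hq he

theorem reg_of_iter [CharZero C] (ht : Transcendental C t) (hgen : IntermediateField.adjoin C {t} = ⊤)
    (hn : n ≠ 0) (hd : d (t ^ n) = 1) {a : C} (ha : a ≠ 0)
    {e : E} (j : ℕ) (h : Reg t a (d^[j] e)) : Reg t a e := by
  rcases Reg_or_Pole ht hgen a e with h1 | ⟨m, hm, h1⟩
  · exact h1
  · exact ((h1.iter d ht hn hd ha hm j).not_reg ht (by omega) h).elim

theorem der_zpow [CharZero C] (t0 : t ≠ 0) (hn : n ≠ 0) (hd : d (t ^ n) = 1) (k : ℤ) :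
    d (t ^ k) = ((k : C) / n) • t ^ (k - n) := by
  have := Algebra.charZero_of_charZero C E
  have h := der_t d hd
  have hn' : (n : E) ≠ 0 := by exact_mod_cast hn
  have hdt : d t = t / (n * t ^ n) := by
    obtain ⟨m, rfl⟩ := Nat.exists_eq_succ_of_ne_zero hn
    simp only [Nat.succ_eq_add_one, Nat.add_sub_cancel] at *
    rw [eq_div_iff (by positivity), pow_succ]
    linear_combination t * h
  have hpos : ∀ m : ℕ, d (t ^ m) = m * t ^ m / (n * t ^ n) := by
    intro m
    rw [Derivation.leibniz_pow, hdt]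
    rcases m with _ | m
    · simp
    · simp [pow_succ]; field_simp
  have hE : ((k : C) / n) • t ^ (k - n) = k * t ^ k / (n * t ^ n) := by
    rw [Algebra.smul_def, map_div₀, map_intCast, map_natCast, zpow_sub₀ t0, zpow_natCast]
    field_simp
  rw [hE]
  rcases Int.eq_nat_or_neg k with ⟨m, rfl | rfl⟩
  · rw [zpow_natCast, hpos]; simp
  · rw [zpow_neg, zpow_natCast, ← one_div, der_div d _ _ (by positivity), hpos]
    simp
    field_simp

noncomputable def del (C : Type*) [Field C] (n : ℕ) : (ℤ →₀ C) →ₗ[C] (ℤ →₀ C) :=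
  Finsupp.linearCombination C (fun k : ℤ => Finsupp.single (k - n) ((k : C) / n))

theorem del_apply (n : ℕ) (F : ℤ →₀ C) (k : ℤ) : del C n F k = ((k + n : ℤ) : C) / n * F (k + n) := by
  induction F using Finsupp.induction_linear with
  | zero => simp
  | add f g hf hg => rw [map_add, Finsupp.add_apply, hf, hg, Finsupp.add_apply]; ring
  | single i c =>
    rw [del, Finsupp.linearCombination_single, Finsupp.smul_apply, Finsupp.single_apply, Finsupp.single_apply]
    by_cases h : i = k + n
    · subst h; simp [mul_comm]
    · rw [if_neg h, if_neg (by omega)]; simp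

theorem del_comm [CharZero C] (t0 : t ≠ 0) (hn : n ≠ 0) (hd : d (t ^ n) = 1) (F : ℤ →₀ C) :
    d (Finsupp.linearCombination C (fun k : ℤ => t ^ k) F) =
      Finsupp.linearCombination C (fun k : ℤ => t ^ k) (del C n F) := by
  induction F using Finsupp.induction_linear with
  | zero => simp
  | add f g hf hg => simp only [map_add, hf, hg]
  | single i c =>
    rw [del, Finsupp.linearCombination_single, Finsupp.linearCombination_single, Derivation.map_smul,
      der_zpow d t0 hn hd, map_smul, Finsupp.linearCombination_single]

theorem del_comm_iter [CharZero C] (t0 : t ≠ 0) (hn : n ≠ 0) (hd : d (t ^ n) = 1) (F : ℤ →₀ C) (j : ℕ) :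
    d^[j] (Finsupp.linearCombination C (fun k : ℤ => t ^ k) F) =
      Finsupp.linearCombination C (fun k : ℤ => t ^ k) ((del C n)^[j] F) := by
  induction j with
  | zero => rfl
  | succ j ih => rw [Function.iterate_succ_apply', Function.iterate_succ_apply', ih, del_comm d t0 hn hd]

theorem del_zero (n : ℕ) (F : ℤ →₀ C) (j : ℕ) : ∀ m : ℕ, 1 ≤ m → m ≤ j →
    ((del C n)^[j] F) (-(m * n : ℤ)) = 0 := by
  induction j with
  | zero => intro m h1 h2; omega
  | succ j ih =>
    intro m h1 h2
    rw [Function.iterate_succ_apply', del_apply]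
    obtain ⟨m, rfl⟩ := Nat.exists_eq_add_of_le' h1
    have e : (-(((m + 1 : ℕ) : ℤ) * n) + n : ℤ) = -(m * n : ℤ) := by push_cast; ring
    rw [e]
    rcases Nat.eq_zero_or_pos m with rfl | hm
    · simp
    · rw [ih m hm (by omega), mul_zero]

/-- exponents allowed -/
def K (n : ℕ) : Set ℤ := {k | (n : ℤ) ∣ k → 0 ≤ k}

def S (C : Type*) [Field C] [Algebra C E] (t : E) (n : ℕ) : Submodule C E :=
  Submodule.span C ((fun k : ℤ => t ^ k) '' K n)

theorem S_int [CharZero C] (t0 : t ≠ 0) (hn : n ≠ 0) (hd : d (t ^ n) = 1) {g : E} (hg : g ∈ S C t n) :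
    ∃ η ∈ S C t n, d η = g := by
  induction hg using Submodule.span_induction with
  | mem x hx =>
    obtain ⟨k, hk, rfl⟩ := hx
    have hk' : k + n ≠ 0 := by
      intro h
      have : k = -n := by omega
      subst this
      have := hk (by simp)
      omega
    have hk2 : ((k + n : ℤ) : C) ≠ 0 := by exact_mod_cast hk'
    have hn' : (n : C) ≠ 0 := by exact_mod_cast hn
    refine ⟨((n : C) / (k + n : ℤ)) • t ^ (k + n), Submodule.smul_mem _ _ (Submodule.subset_span ⟨k + n, ?_, rfl⟩), ?_⟩
    · intro h
      have := hk (by simpa using h)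
      omega
    · rw [Derivation.map_smul, der_zpow d t0 hn hd, smul_smul]
      simp only [add_sub_cancel_right]
      rw [div_mul_div_cancel₀ hk2, div_self hn', one_smul]
  | zero => exact ⟨0, Submodule.zero_mem _, by simp⟩
  | add x y _ _ hx hy =>
    obtain ⟨a, ha, rfl⟩ := hx
    obtain ⟨b, hb, rfl⟩ := hy
    exact ⟨a + b, Submodule.add_mem _ ha hb, by simp⟩
  | smul c x _ hx =>
    obtain ⟨a, ha, rfl⟩ := hx
    exact ⟨c • a, Submodule.smul_mem _ _ ha, by simp⟩

theorem S_iter [CharZero C] (t0 : t ≠ 0) (hn : n ≠ 0) (hd : d (t ^ n) = 1) (j : ℕ) : ∀ {g : E}, g ∈ S C t n →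
    ∃ η ∈ S C t n, d^[j] η = g := by
  induction j with
  | zero => intro g hg; exact ⟨g, hg, rfl⟩
  | succ j ih =>
    intro g hg
    obtain ⟨η, h1, rfl⟩ := S_int d t0 hn hd hg
    obtain ⟨θ, h3, rfl⟩ := ih h1
    exact ⟨θ, h3, by rw [Function.iterate_succ_apply']⟩

theorem mem_S_of_int [CharZero C] [IsAlgClosed C] (ht : Transcendental C t)
    (hgen : IntermediateField.adjoin C {t} = ⊤) (hn : n ≠ 0) (hd : d (t ^ n) = 1)
    {g : E} (h : ∀ j : ℕ, 1 ≤ j → ∃ η : E, d^[j] η = g) : g ∈ S C t n := by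
  have t0 : t ≠ 0 := by
    have := ev_ne ht (X_ne_zero (R := C)); simpa using this
  have hreg : ∀ a : C, a ≠ 0 → Reg t a g := fun a ha => reg_of_int d ht hgen hn hd ha h
  have hg := mem_span_of_reg ht hgen g hreg
  rw [Finsupp.mem_span_range_iff_exists_finsupp] at hg
  obtain ⟨G, hG⟩ := hg
  change Finsupp.linearCombination C (fun k : ℤ => t ^ k) G = g at hG
  have hz : ∀ m : ℕ, 1 ≤ m → G (-(m * n : ℤ)) = 0 := by
    intro m hm
    obtain ⟨η, hη⟩ := h m hm
    have h1 := mem_span_of_reg ht hgen η fun a ha =>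
      reg_of_iter d ht hgen hn hd ha m (hη ▸ hreg a ha)
    rw [Finsupp.mem_span_range_iff_exists_finsupp] at h1
    obtain ⟨H, hH⟩ := h1
    change Finsupp.linearCombination C (fun k : ℤ => t ^ k) H = η at hH
    rw [← hH, del_comm_iter d t0 hn hd, ← hG] at hη
    rw [← linInd ht hη]
    exact del_zero n H m m hm le_rfl
  rw [← hG, Finsupp.linearCombination_apply]
  refine Submodule.sum_mem _ fun k hk => Submodule.smul_mem _ _ (Submodule.subset_span ⟨k, ?_, rfl⟩)
  rintro ⟨b, rfl⟩
  by_contra hneg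
  rw [Finsupp.mem_support_iff] at hk
  apply hk
  have hb : b < 0 := by
    by_contra hb; exact hneg (mul_nonneg (by positivity) (by omega))
  have := hz b.natAbs (by omega)
  rw [← this]
  congr 1
  rw [Int.natCast_natAbs, abs_of_neg hb]; ring

theorem adj_zpow (x : E) (k : ℤ) : x ^ k ∈ Algebra.adjoin C {x, x⁻¹} := by
  rcases Int.eq_nat_or_neg k with ⟨m, rfl | rfl⟩
  · rw [zpow_natCast]; exact pow_mem (Algebra.subset_adjoin (by simp)) _
  · rw [zpow_neg, zpow_natCast, ← inv_pow]; exact pow_mem (Algebra.subset_adjoin (by simp)) _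

def Good (C : Type*) [Field C] [Algebra C E] (t : E) (n : ℕ) (f : Fin n → E) : Prop :=
  (∀ i : Fin n, (i : ℕ) = 0 → f i ∈ Algebra.adjoin C {t ^ n}) ∧
       (∀ i : Fin n, 1 ≤ (i : ℕ) → f i ∈ Algebra.adjoin C {t ^ n, (t ^ n)⁻¹})

theorem S_good (t0 : t ≠ 0) (hn : n ≠ 0) {g : E} (hg : g ∈ S C t n) :
    ∃ f : Fin n → E, Good C t n f ∧ g = ∑ i, f i * t ^ (i : ℕ) := by
  classical
  induction hg using Submodule.span_induction with
  | mem x hx =>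
    obtain ⟨k, hk, rfl⟩ := hx
    have hnpos : (0 : ℤ) < n := by omega
    have h0 := Int.emod_nonneg k hnpos.ne'
    have h1 := Int.emod_lt_of_pos k hnpos
    have h2 := Int.emod_add_mul_ediv k n
    let i : Fin n := ⟨(k % n).toNat, by omega⟩
    have hi : ((i : ℕ) : ℤ) = k % n := Int.toNat_of_nonneg h0
    refine ⟨Pi.single i ((t ^ n) ^ (k / n)), ⟨?_, ?_⟩, ?_⟩
    · intro l hl
      by_cases hli : l = i
      · subst hli
        rw [Pi.single_eq_same]
        have hdv : (n : ℤ) ∣ k := Int.dvd_of_emod_eq_zero (by omega)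
        have hk0 := hk hdv
        have : 0 ≤ k / n := Int.ediv_nonneg hk0 hnpos.le
        obtain ⟨m, hm⟩ := Int.eq_ofNat_of_zero_le this
        rw [hm, zpow_natCast]
        exact pow_mem (Algebra.subset_adjoin (by simp)) _
      · rw [Pi.single_eq_of_ne hli]; exact zero_mem _
    · intro l _
      by_cases hli : l = i
      · subst hli
        rw [Pi.single_eq_same]
        exact adj_zpow _ _
      · rw [Pi.single_eq_of_ne hli]; exact zero_mem _
    · rw [Finset.sum_eq_single i]
      · rw [Pi.single_eq_same, ← zpow_natCast t i, hi, ← zpow_natCast t n, ← zpow_mul, ← zpow_add₀ t0, add_comm, h2]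
      · intro b _ hb; rw [Pi.single_eq_of_ne hb, zero_mul]
      · simp
  | zero => exact ⟨0, ⟨fun _ _ => zero_mem _, fun _ _ => zero_mem _⟩, by simp⟩
  | add x y _ _ hx hy =>
    obtain ⟨a, ha, rfl⟩ := hx
    obtain ⟨b, hb, rfl⟩ := hy
    exact ⟨a + b, ⟨fun i hi => add_mem (ha.1 i hi) (hb.1 i hi), fun i hi => add_mem (ha.2 i hi) (hb.2 i hi)⟩,
      by simp [add_mul, Finset.sum_add_distrib]⟩
  | smul c x _ hx =>
    obtain ⟨a, ha, rfl⟩ := hx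
    exact ⟨c • a, ⟨fun i hi => Subalgebra.smul_mem _ (ha.1 i hi) c, fun i hi => Subalgebra.smul_mem _ (ha.2 i hi) c⟩,
      by simp [Finset.smul_sum]⟩

theorem good_S (t0 : t ≠ 0) (f : Fin n → E) (h : Good C t n f) :
    ∑ i, f i * t ^ (i : ℕ) ∈ S C t n := by
  refine Submodule.sum_mem _ fun i _ => ?_
  have key : ∀ (s : Set E) (T : Set ℤ), (∀ x ∈ Submonoid.closure s, ∃ k ∈ T, x = (t ^ n) ^ k) →
      (∀ k ∈ T, (n * k + (i : ℕ) : ℤ) ∈ K n) → f i ∈ Algebra.adjoin C s → f i * t ^ (i : ℕ) ∈ S C t n := by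
    intro s T h1 h2 h3
    generalize f i = y at h3
    rw [← Subalgebra.mem_toSubmodule, Algebra.adjoin_eq_span] at h3
    induction h3 using Submodule.span_induction with
    | mem x hx =>
      obtain ⟨k, hk, rfl⟩ := h1 x hx
      refine Submodule.subset_span ⟨_, h2 k hk, ?_⟩
      simp only
      rw [zpow_add₀ t0, zpow_mul, zpow_natCast, zpow_natCast]
    | zero => rw [zero_mul]; exact zero_mem _
    | add x y _ _ hx hy => rw [add_mul]; exact add_mem hx hy
    | smul c x _ hx => rw [smul_mul_assoc]; exact Submodule.smul_mem _ _ hx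
  have tn0 : t ^ n ≠ 0 := pow_ne_zero _ t0
  rcases Nat.eq_zero_or_pos i with hi | hi
  · refine key _ {k | 0 ≤ k} ?_ ?_ (h.1 i hi)
    · intro x hx
      obtain ⟨m, rfl⟩ := Submonoid.mem_closure_singleton.mp hx
      exact ⟨m, by simp, by simp⟩
    · intro k hk _
      have : (0 : ℤ) ≤ k := hk
      positivity
  · refine key _ Set.univ ?_ ?_ (h.2 i hi)
    · intro x hx
      induction hx using Submonoid.closure_induction with
      | mem x hx =>
        rcases hx with rfl | rfl
        · exact ⟨1, trivial, by simp⟩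
        · exact ⟨-1, trivial, by simp⟩
      | one => exact ⟨0, trivial, by simp⟩
      | mul x y _ _ hx hy =>
        obtain ⟨a, _, rfl⟩ := hx
        obtain ⟨b, _, rfl⟩ := hy
        exact ⟨a + b, trivial, by rw [zpow_add₀ tn0]⟩
    · intro k _ hdv
      exfalso
      have h5 : (n : ℤ) ∣ (i : ℕ) := (Int.dvd_add_right (Dvd.intro _ rfl)).mp hdv
      have h6 := Nat.le_of_dvd hi (Int.natCast_dvd_natCast.mp h5)
      have := i.2
      omega

theorem adj_le (x : E) : Algebra.adjoin C {x, x⁻¹} ≤ (IntermediateField.adjoin C {x}).toSubalgebra := by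
  apply Algebra.adjoin_le
  have hx : x ∈ IntermediateField.adjoin C {x} := IntermediateField.mem_adjoin_simple_self C x
  rintro y (rfl | rfl)
  · exact hx
  · exact (IntermediateField.adjoin C {x}).inv_mem hx

theorem Good.mem {f : Fin n → E} (h : Good C t n f) (i : Fin n) : f i ∈ IntermediateField.adjoin C {t ^ n} := by
  apply adj_le (t ^ n)
  rcases Nat.eq_zero_or_pos i with hi | hi
  · exact Algebra.adjoin_mono (by simp) (h.1 i hi)
  · exact h.2 i hi

end der
end S16



/-- in `E = C(x^{1/n}) = C(t)` with `(tⁿ)' = 1` (so `x = tⁿ`,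
`x' = 1`), write `g = Σ_{i=0}^{n-1} f_i·tⁱ` with `f_i ∈ C(x)`; then `g` is
∞-integrable in `E` iff `f₀ ∈ C[x]` and `f_i ∈ C[x, x⁻¹]` for `1 ≤ i ≤ n-1`. -/
theorem stmt_16 (C E : Type*) [Field C] [Field E] [Algebra C E]
    [CharZero C] [IsAlgClosed C]
    (D : E → E)
    (hadd : ∀ a b : E, D (a + b) = D a + D b)
    (hmul : ∀ a b : E, D (a * b) = a * D b + D a * b)
    (hCc : ∀ c : C, D (algebraMap C E c) = 0)
    (n : ℕ) (hn : 2 ≤ n)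
    (t : E) (httr : Transcendental C t)
    (hgen : IntermediateField.adjoin C {t} = ⊤)
    (ht : D (t ^ n) = 1)
    (hconst : ∀ c : E, D c = 0 → ∃ a : C, algebraMap C E a = c)
    (g : E) (f : Fin n → E)
    (hf : ∀ i : Fin n, f i ∈ IntermediateField.adjoin C {t ^ n})
    (hg : g = ∑ i : Fin n, f i * t ^ (i : ℕ)) :
    (∀ j : ℕ, 1 ≤ j → ∃ η : E, D^[j] η = g) ↔
      ((∀ i : Fin n, (i : ℕ) = 0 → f i ∈ Algebra.adjoin C {t ^ n}) ∧
       (∀ i : Fin n, 1 ≤ (i : ℕ) → f i ∈ Algebra.adjoin C {t ^ n, (t ^ n)⁻¹})) := by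
  have hn0 : n ≠ 0 := by omega
  have t0 : t ≠ 0 := by
    have := S16.ev_ne httr (Polynomial.X_ne_zero (R := C)); simpa using this
  let L : E →ₗ[C] E :=
    { toFun := D
      map_add' := hadd
      map_smul' := fun c x => by simp [Algebra.smul_def, hmul, hCc] }
  let d : Derivation C E E := Derivation.mk' L (fun a b => by
    change D (a * b) = a * D b + b * D a
    rw [hmul, mul_comm b])
  have hdD : (d : E → E) = D := rfl
  have hd : d (t ^ n) = 1 := ht
  rw [← hdD]
  change _ ↔ S16.Good C t n f
  constructor
  · intro h
    obtain ⟨f', h1, h2⟩ := S16.S_good t0 hn0 (S16.mem_S_of_int d httr hgen hn0 hd h)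
    have h3 := S16.uniq httr hn0 (fun i => f i - f' i) (fun i => sub_mem (hf i) (h1.mem i)) (by
      simp only [sub_mul, Finset.sum_sub_distrib]
      rw [← hg, ← h2, sub_self])
    have h4 : f = f' := funext fun i => sub_eq_zero.mp (h3 i)
    rw [h4]; exact h1
  · intro h j _
    obtain ⟨η, _, h1⟩ := S16.S_iter d t0 hn0 hd j (S16.good_S t0 f h)
    exact ⟨η, h1.trans hg.symm⟩
end
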